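/- arXiv:2111.09479 — 3 statements merged into one kernel-verified Lean document; each statement's English description precedes it below -/
import Mathlib

section
/- Let A be an essentially small hereditary abelian category, linear over a finite field F_q, with finite-dimensional Hom and Ext spaces. For any objects A, B, M of A, the number of morphisms f ∈ Hom_{D₁(A)}(A,B) whose cone is isomorphic to M equals the sum, over all isomorphism classes [X•] of 1-periodic complexes X• with H(X•) ≅ M, of |Ext¹_{C₁(A)}(A,B)_{X•}|, the number of extension classes of the stalk complex A by the stalk complex B with middle term isomorphic to X•. -/
/-!
Formalization of statements from "ıquantum groups of split type via derived Hall algebras"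
(Chen–Lu–Ruan).  We set up 1-periodic complexes, the 1-periodic derived category,
derived Hall algebras and ıHall algebras.
-/

open CategoryTheory Limits

noncomputable section

universe w w' w'' v u

/-- The type of isomorphism classes of objects of a category. -/
abbrev IsoCls (C : Type u) [Category.{v} C] : Type u :=
  Quotient (CategoryTheory.isIsomorphicSetoid C)

/-- The isomorphism class `[X]` of an object `X`. -/
abbrev mkIso {C : Type u} [Category.{v} C] (X : C) : IsoCls C :=
  Quotient.mk (CategoryTheory.isIsomorphicSetoid C) X

/-- The complex shape whose homological complexes are the `1`-periodic complexes
`(X, d)` with `d : X ⟶ X`, `d ∘ d = 0`. -/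
def oneShape : ComplexShape Unit where
  Rel _ _ := True
  next_eq _ _ := rfl
  prev_eq _ _ := rfl

/-- The category `C₁(A)` of `1`-periodic complexes over `A`. -/
abbrev OnePeriodic (A : Type u) [Category.{v} A] [Abelian A] := HomologicalComplex A oneShape

section OnePeriodicDefs

variable {A : Type u} [Category.{v} A] [Abelian A]

/-- The stalk complex `C_X = (X, 0)`. -/
def stalkC (X : A) : OnePeriodic A where
  X _ := X
  d _ _ := 0
  shape _ _ h := absurd trivial h
  d_comp_d' := by intros; simp

/-- The morphism of stalk complexes induced by a morphism of `A`. -/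
def stalkHom {X Y : A} (f : X ⟶ Y) : stalkC X ⟶ stalkC Y where
  f _ := f
  comm' := by intros; simp [stalkC]

/-- The acyclic complex `K_X = (X ⊕ X, (0 1 // 0 0))`. -/
def KC (X : A) : OnePeriodic A where
  X _ := X ⊞ X
  d _ _ := biprod.snd ≫ biprod.inl
  shape _ _ h := absurd trivial h
  d_comp_d' := by intros; simp

/-- A `1`-periodic complex is acyclic if `ker d = Im d`, i.e. if it is exact. -/
def IsAcyclic (K : OnePeriodic A) : Prop := ∀ i, K.ExactAt i

/-- The cohomology `H(X•) = ker d / Im d` of a `1`-periodic complex. -/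
abbrev cohomology (M : OnePeriodic A) : A := M.homology ()

/-- The underlying object `res(M•)` of a `1`-periodic complex (restriction functor,
forgetting the differential). -/
abbrev resOP (M : OnePeriodic A) : A := M.X ()

/-- The image `Im d` of the differential of a `1`-periodic complex. -/
def imd (M : OnePeriodic A) : A := Limits.image (M.d () ())

/-- The mapping cone of a morphism of `1`-periodic complexes:
`Y ⊕ X` with differential `(d_Y g // 0 -d_X)`. -/
def cone1 {X Y : OnePeriodic A} (g : X ⟶ Y) : OnePeriodic A where
  X _ := Y.X () ⊞ X.X ()
  d _ _ := biprod.desc (Y.d () () ≫ biprod.inl) (g.f () ≫ biprod.inl - X.d () () ≫ biprod.inr)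
  shape _ _ h := absurd trivial h
  d_comp_d' := by
    intros
    apply biprod.hom_ext'
    · rw [biprod.inl_desc_assoc, Category.assoc, biprod.inl_desc, ← Category.assoc,
        HomologicalComplex.d_comp_d, zero_comp, comp_zero]
    · rw [biprod.inr_desc_assoc, Preadditive.sub_comp, Category.assoc, Category.assoc,
        biprod.inl_desc, biprod.inr_desc, comp_zero, ← Category.assoc,
        HomologicalComplex.Hom.comm, Category.assoc, Preadditive.comp_sub, ← Category.assoc,
        ← Category.assoc, HomologicalComplex.d_comp_d, zero_comp, sub_zero, sub_self]

end OnePeriodicDefs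

section DerivedCategoryOne

variable {A : Type u} [Category.{v} A] [Abelian A]
  [MorphismProperty.HasLocalization.{w'} (HomologicalComplex.quasiIso A oneShape)]

/-- The `1`-periodic derived category `D₁(A)`: the localization of (the homotopy category of)
`C₁(A)` at the quasi-isomorphisms. -/
abbrev DOne (A : Type u) [Category.{v} A] [Abelian A]
    [MorphismProperty.HasLocalization.{w'} (HomologicalComplex.quasiIso A oneShape)] :=
  HomologicalComplexUpToQuasiIso A oneShape

/-- The localization functor `C₁(A) ⥤ D₁(A)`. -/
abbrev QD : OnePeriodic A ⥤ DOne A := HomologicalComplexUpToQuasiIso.Q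

/-- The number of morphisms `A ⟶ B` in `D₁(A)` (for stalk complexes). -/
def homD1Card (X Y : A) : ℕ := Nat.card (QD.obj (stalkC X) ⟶ QD.obj (stalkC Y))

/-- `ã_X`, the number of automorphisms of `X` in `D₁(A)`. -/
def autD1 (X : A) : ℕ := Nat.card (Aut (QD.obj (stalkC X)))

/-- `{X,Y} = 1 / |Hom_{D₁(A)}(X,Y)|`. -/
def braceD (X Y : A) : ℝ := ((homD1Card X Y : ℝ))⁻¹

/-- `M` is a cone of the morphism `f : X ⟶ Y` of `D₁(A)`: writing `f` as a right fraction
`Q(s)⁻¹ ≫ Q(g)` with `s` a quasi-isomorphism of `1`-periodic complexes, the mapping cone of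
`g` is isomorphic to `M` in `D₁(A)`. -/
def IsConeOf {X Y : A} (f : QD.obj (stalkC X) ⟶ QD.obj (stalkC Y)) (M : A) : Prop :=
  ∃ (Z : OnePeriodic A) (s : Z ⟶ stalkC X) (g : Z ⟶ stalkC Y),
    HomologicalComplex.quasiIso A oneShape s ∧ QD.map s ≫ f = QD.map g ∧
      Nonempty (QD.obj (cone1 g) ≅ QD.obj (stalkC M))

/-- `|(X,Y)_M|`, the number of morphisms `f ∈ Hom_{D₁(A)}(X,Y)` with cone isomorphic
to `M`. -/
def coneCount (X Y M : A) : ℕ :=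
  Nat.card {f : QD.obj (stalkC X) ⟶ QD.obj (stalkC Y) // IsConeOf f M}

/-- The derived Hall number `G_{XY}^M`, given by the derived Riedtmann–Peng formula
`G_{XY}^M = (ã_M |(X,Y)_M| / (ã_X ã_Y)) √({X,Y}{M,M}/({X,X}{Y,Y}))`. -/
def Gnum (X Y M : A) : ℝ :=
  ((autD1 M : ℝ) * (coneCount X Y M : ℝ)) / ((autD1 X : ℝ) * (autD1 Y : ℝ)) *
    Real.sqrt ((braceD X Y * braceD M M) / (braceD X X * braceD Y Y))

end DerivedCategoryOne

open Abelian in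
/-- The class `e ∈ Ext¹(M,N)` is represented by an extension with middle term isomorphic
to `X`. -/
def extHasMiddle {C : Type u} [Category.{v} C] [Abelian C] [HasExt.{w} C]
    (M N X : C) (e : Abelian.Ext M N 1) : Prop :=
  ∃ (S : ShortComplex C) (hS : S.ShortExact) (i₁ : S.X₁ ≅ N) (i₃ : M ≅ S.X₃),
    Nonempty (S.X₂ ≅ X) ∧
      (Ext.mk₀ i₃.hom).comp (hS.extClass.comp (Ext.mk₀ i₁.hom) (add_zero 1)) (zero_add 1) = e

/-- `|Ext¹(M,N)_X|`: the number of classes in `Ext¹(M,N)` of extensions with middle term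
isomorphic to `X`. -/
def extMiddleCard {C : Type u} [Category.{v} C] [Abelian C] [HasExt.{w} C]
    (M N X : C) : ℕ :=
  Nat.card {e : Abelian.Ext M N 1 // extHasMiddle M N X e}

section ExtensionLemmas

open Abelian

namespace CategoryTheory

variable {C : Type u} [Category.{v} C] [Abelian C]

lemma ShortComplex.ShortExact.exists_pushout {T : ShortComplex C} (hT : T.ShortExact) {Y : C}
    (h : T.X₁ ⟶ Y) :
    ∃ (E : C) (i : Y ⟶ E) (p : E ⟶ T.X₃) (w : i ≫ p = 0) (_ : (ShortComplex.mk i p w).ShortExact)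
      (ψ : T.X₂ ⟶ E), T.f ≫ ψ = h ≫ i ∧ ψ ≫ p = T.g := by
  have := hT.mono_f
  have := hT.epi_g
  have hw : T.f ≫ T.g = h ≫ 0 := by rw [T.zero, comp_zero]
  have w : pushout.inr T.f h ≫ pushout.desc T.g 0 hw = 0 := pushout.inr_desc _ _ _
  refine ⟨pushout T.f h, pushout.inr _ _, pushout.desc T.g 0 hw, w, ?_,
    pushout.inl _ _, pushout.condition, pushout.inl_desc _ _ _⟩
  have hepi : Epi (pushout.desc T.g 0 hw) := epi_of_epi_fac (pushout.inl_desc T.g 0 hw)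
  refine
    { exact := ShortComplex.exact_of_g_is_cokernel _ ?_
      mono_f := by dsimp; infer_instance
      epi_g := hepi }
  have aux : ∀ {W : C} (k : pushout T.f h ⟶ W), pushout.inr T.f h ≫ k = 0 →
      T.f ≫ pushout.inl T.f h ≫ k = 0 := fun k hk => by
    rw [pushout.condition_assoc, hk, comp_zero]
  refine CokernelCofork.IsColimit.ofπ _ _
    (fun k hk => hT.gIsCokernel.desc (CokernelCofork.ofπ (pushout.inl _ _ ≫ k) (aux k hk)))
    (fun k hk => ?_) (fun k hk b hb => ?_)
  · have := hT.gIsCokernel.fac (CokernelCofork.ofπ (pushout.inl _ _ ≫ k) (aux k hk))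
      WalkingParallelPair.one
    dsimp at this hk ⊢
    apply pushout.hom_ext
    · rw [pushout.inl_desc_assoc]
      exact this
    · rw [pushout.inr_desc_assoc, hk, zero_comp]
  · have := hT.gIsCokernel.fac (CokernelCofork.ofπ (pushout.inl _ _ ≫ k) (aux k hk))
      WalkingParallelPair.one
    dsimp at this hb
    rw [← cancel_epi T.g]
    refine Eq.trans ?_ this.symm
    rw [← hb, pushout.inl_desc_assoc]

lemma Abelian.Ext.exists_epi_comp_eq_zero [HasExt.{w} C] {X Y : C} (e : Ext X Y 1) :
    ∃ (X' : C) (p : X' ⟶ X) (_ : Epi p), (Ext.mk₀ p).comp e (zero_add 1) = 0 := by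
  let := HasDerivedCategory.standard C
  let sX := (CochainComplex.singleFunctor C 0).obj X
  let sY := (CochainComplex.singleFunctor C 0).obj Y
  let f : DerivedCategory.Q.obj sX ⟶ DerivedCategory.Q.obj (sY⟦(1 : ℤ)⟧) :=
    (DerivedCategory.singleFunctorIsoCompQ C 0).inv.app X ≫ e.hom ≫
    ((DerivedCategory.singleFunctorIsoCompQ C 0).hom.app Y)⟦(1 : ℤ)⟧' ≫
      (DerivedCategory.Q.commShiftIso (1 : ℤ)).inv.app sY
  have : sX.IsStrictlyLE 0 := by dsimp [sX]; infer_instance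
  obtain ⟨X', _, s, hs, g, hf⟩ := DerivedCategory.right_fac_of_isStrictlyLE f 0
  have hd : X'.d 0 1 = 0 := (X'.isZero_of_isStrictlyLE 0 1 (by lia)).eq_of_tgt _ _
  rw [DerivedCategory.isIso_Q_map_iff_quasiIso] at hs
  let σ : (CochainComplex.singleFunctor C 0).obj (X'.X 0) ⟶ X' :=
    HomologicalComplex.mkHomFromSingle (𝟙 _) (by
      rintro j rfl
      simpa using hd)
  let p : X'.X 0 ⟶ X := s.f 0 ≫ (HomologicalComplex.singleObjXSelf _ 0 X).hom
  have hσ : σ ≫ s = (CochainComplex.singleFunctor C 0).map p := by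
    apply HomologicalComplex.from_single_hom_ext
    have h1 := HomologicalComplex.single_map_f_self (c := ComplexShape.up ℤ) 0 p
    have h2 := HomologicalComplex.mkHomFromSingle_f (c := ComplexShape.up ℤ) (K := X') (j := 0)
      (𝟙 _) (by
        rintro j rfl
        simpa using hd)
    refine Eq.trans ?_ h1.symm
    rw [HomologicalComplex.comp_f]
    simp only [σ, p, h2, Category.comp_id]
    congr 1
    exact (Category.comp_id _).symm.trans ((congrArg (s.f 0 ≫ ·)
      (HomologicalComplex.singleObjXSelf (ComplexShape.up ℤ) 0 X).hom_inv_id.symm).trans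
      (Category.assoc _ _ _).symm)
  have hp : Epi p := by
    have h0 : Epi (HomologicalComplex.homologyMap s 0) := inferInstance
    rw [HomologicalComplex.epi_homologyMap_iff_up_to_refinements s (-1) 0 1 (by simp) (by simp)]
      at h0
    have : Epi (s.f 0) := by
      rw [epi_iff_surjective_up_to_refinements]
      intro A y
      obtain ⟨A', π, hπ, x, -, z, hx⟩ := h0 y Limits.comp_zero
      exact ⟨A', π, hπ, x, hx.trans (by erw [Limits.comp_zero, add_zero])⟩
    have : Epi (HomologicalComplex.singleObjXSelf (ComplexShape.up ℤ) 0 X).hom := inferInstance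
    exact @epi_comp _ _ _ _ _ _ ‹_› _ this
  refine ⟨X'.X 0, p, hp, ?_⟩
  have hσg : σ ≫ g = 0 := by
    apply HomologicalComplex.from_single_hom_ext
    apply IsZero.eq_of_tgt
    exact HomologicalComplex.isZero_single_obj_X (ComplexShape.up ℤ) 0 Y (0 + 1) (by simp)
  ext
  rw [← Ext.singleFunctor_map_comp_hom]
  have h3 : DerivedCategory.Q.map ((CochainComplex.singleFunctor C 0).map p) ≫ f = 0 := by
    rw [hf, ← hσ, Functor.map_comp, Category.assoc, IsIso.hom_inv_id_assoc,
      ← Functor.map_comp, hσg, Functor.map_zero]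
  have h4 : (DerivedCategory.singleFunctor C 0).map p ≫ e.hom =
    (DerivedCategory.singleFunctorIsoCompQ C 0).hom.app _ ≫
      (DerivedCategory.Q.map ((CochainComplex.singleFunctor C 0).map p) ≫ f) ≫
      (DerivedCategory.Q.commShiftIso (1 : ℤ)).hom.app sY ≫
      ((DerivedCategory.singleFunctorIsoCompQ C 0).inv.app Y)⟦(1 : ℤ)⟧' := by
    have := (DerivedCategory.singleFunctorIsoCompQ C 0).hom.naturality p
    dsimp only [Functor.comp_map] at this
    rw [Category.assoc, ← reassoc_of% this]
    simp [f, ← Functor.map_comp]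
  rw [h4, h3, Ext.zero_hom]
  simp

lemma ShortComplex.ShortExact.exists_hom [HasExt.{w} C] {S₁ S₂ : ShortComplex C}
    (h₁ : S₁.ShortExact) (h₂ : S₂.ShortExact) (a : S₁.X₁ ⟶ S₂.X₁) (c : S₁.X₃ ⟶ S₂.X₃)
    (h : h₁.extClass.comp (Ext.mk₀ a) (add_zero 1) = (Ext.mk₀ c).comp h₂.extClass (zero_add 1)) :
    ∃ b : S₁.X₂ ⟶ S₂.X₂, S₁.f ≫ b = a ≫ S₂.f ∧ b ≫ S₂.g = S₁.g ≫ c := by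
  have := h₂.mono_f
  obtain ⟨x₂, hx₂⟩ := Ext.covariant_sequence_exact₃ _ h₂ (Ext.mk₀ (S₁.g ≫ c)) (zero_add 1) (by
    rw [← Ext.mk₀_comp_mk₀, Ext.comp_assoc (a₁₂ := 0) (a₂₃ := 1) _ _ _ (by lia) (by lia) (by lia),
      ← h, h₁.comp_extClass_assoc])
  obtain ⟨b, rfl⟩ := (Ext.mk₀_bijective _ _).2 x₂
  have hb : b ≫ S₂.g = S₁.g ≫ c := (Ext.mk₀_bijective _ _).1 (by rw [← Ext.mk₀_comp_mk₀, hx₂])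
  let a' : S₁.X₁ ⟶ S₂.X₁ := h₂.fIsKernel.lift (KernelFork.ofι (S₁.f ≫ b) (by simp [hb]))
  have ha' : a' ≫ S₂.f = S₁.f ≫ b := h₂.fIsKernel.fac _ WalkingParallelPair.zero
  have key := extClass_naturality h₁ h₂ ⟨a', b, c, ha', hb⟩
  obtain ⟨y, hy⟩ := Ext.contravariant_sequence_exact₁ h₁ S₂.X₁ (Ext.mk₀ (a' - a)) (add_zero 1) (by
    dsimp only at key
    rw [sub_eq_add_neg, Ext.mk₀_add, Ext.mk₀_neg, Ext.comp_add, Ext.comp_neg, key, h,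
      add_neg_cancel])
  obtain ⟨y, rfl⟩ := (Ext.mk₀_bijective _ _).2 y
  have hy : S₁.f ≫ y = a' - a := (Ext.mk₀_bijective _ _).1 (by rw [← Ext.mk₀_comp_mk₀, hy])
  refine ⟨b - y ≫ S₂.f, ?_, ?_⟩
  · rw [Preadditive.comp_sub, ← Category.assoc, hy, Preadditive.sub_comp, ha']
    abel
  · simp [hb]

lemma Abelian.Ext.exists_extClass_eq [HasExt.{w} C] {X Y : C} (e : Ext X Y 1) :
    ∃ (E : C) (i : Y ⟶ E) (p : E ⟶ X) (w : i ≫ p = 0) (h : (ShortComplex.mk i p w).ShortExact),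
      h.extClass = e := by
  obtain ⟨X', p, _, hp⟩ := exists_epi_comp_eq_zero e
  have hT : (ShortComplex.mk (kernel.ι p) p (kernel.condition p)).ShortExact :=
    { exact := ShortComplex.exact_kernel p }
  obtain ⟨x, hx⟩ := Ext.contravariant_sequence_exact₃ hT Y e hp (add_zero 1)
  obtain ⟨x, rfl⟩ := (Ext.mk₀_bijective _ _).2 x
  obtain ⟨E, i, q, w, h, ψ, h1, h2⟩ := hT.exists_pushout x
  refine ⟨E, i, q, w, h, ?_⟩
  have := ShortComplex.ShortExact.extClass_naturality hT h ⟨x, ψ, 𝟙 _, h1.symm, by simpa using h2⟩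
  simp only [Ext.mk₀_id_comp] at this
  rw [← this]
  exact hx

lemma ShortComplex.ShortExact.exists_lift [HasExt.{w} C] {S : ShortComplex C} (hS : S.ShortExact)
    {P : C} (e : P ⟶ S.X₁) [Epi e] [Subsingleton (Ext S.X₃ (kernel e) 2)] :
    ∃ (N : C) (j : P ⟶ N) (q : N ⟶ S.X₃) (w : j ≫ q = 0) (_ : (ShortComplex.mk j q w).ShortExact)
      (φ : N ⟶ S.X₂), j ≫ φ = e ≫ S.f ∧ φ ≫ S.g = q := by
  have hT : (ShortComplex.mk (kernel.ι e) e (kernel.condition e)).ShortExact :=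
    { exact := ShortComplex.exact_kernel e }
  obtain ⟨x, hx⟩ := Ext.covariant_sequence_exact₃ S.X₃ hT hS.extClass (n₁ := 2) rfl
    (Subsingleton.elim _ _)
  obtain ⟨N, j, q, w, h, rfl⟩ := Ext.exists_extClass_eq x
  obtain ⟨φ, h1, h2⟩ := ShortComplex.ShortExact.exists_hom h hS e (𝟙 _) (by
    rw [Ext.mk₀_id_comp]; exact hx)
  exact ⟨N, j, q, w, h, φ, h1, by simpa using h2⟩

end CategoryTheory

end ExtensionLemmas

section OnePeriodicAPI

namespace OnePeriodic

variable {A : Type u} [Category.{v} A] [Abelian A]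

/-- Constructor for morphisms of `1`-periodic complexes. -/
def mkHom {K L : OnePeriodic A} (f : K.X () ⟶ L.X ())
    (h : f ≫ L.d () () = K.d () () ≫ f) : K ⟶ L where
  f _ := f
  comm' _ _ _ := h

@[simp] lemma mkHom_f {K L : OnePeriodic A} (f : K.X () ⟶ L.X ())
    (h : f ≫ L.d () () = K.d () () ≫ f) : (mkHom f h).f () = f := rfl

@[ext] lemma hom_ext {K L : OnePeriodic A} {f g : K ⟶ L} (h : f.f () = g.f ()) : f = g :=
  HomologicalComplex.hom_ext _ _ fun _ => h

lemma d_sq (K : OnePeriodic A) : K.d () () ≫ K.d () () = 0 := K.d_comp_d _ _ _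

/-- A morphism to a stalk complex. -/
def stalkDesc {Z : OnePeriodic A} {X : A} (a : Z.X () ⟶ X) (h : Z.d () () ≫ a = 0) :
    Z ⟶ stalkC X :=
  mkHom (L := stalkC X) a (comp_zero.trans h.symm)

/-- The underlying morphism of a morphism to a stalk complex. -/
def toStalk {Z : OnePeriodic A} {X : A} (s : Z ⟶ stalkC X) : Z.X () ⟶ X := s.f ()

lemma d_toStalk {Z : OnePeriodic A} {X : A} (s : Z ⟶ stalkC X) : Z.d () () ≫ toStalk s = 0 :=
  (s.comm () ()).symm.trans comp_zero

lemma toStalk_comp {W Z : OnePeriodic A} {X : A} (t : W ⟶ Z) (s : Z ⟶ stalkC X) :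
    toStalk (t ≫ s) = t.f () ≫ toStalk s := rfl

lemma toStalk_ext {Z : OnePeriodic A} {X : A} {s t : Z ⟶ stalkC X} (h : toStalk s = toStalk t) :
    s = t := hom_ext h

@[simp] lemma toStalk_stalkDesc {Z : OnePeriodic A} {X : A} (a : Z.X () ⟶ X)
    (h : Z.d () () ≫ a = 0) : toStalk (stalkDesc a h) = a := rfl

/-- A morphism from a stalk complex. -/
def stalkLift {Z : OnePeriodic A} {X : A} (a : X ⟶ Z.X ()) (h : a ≫ Z.d () () = 0) :
    stalkC X ⟶ Z :=
  mkHom (K := stalkC X) a (h.trans zero_comp.symm)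

/-- The underlying morphism of a morphism from a stalk complex. -/
def ofStalk {Z : OnePeriodic A} {X : A} (s : stalkC X ⟶ Z) : X ⟶ Z.X () := s.f ()

lemma ofStalk_d {Z : OnePeriodic A} {X : A} (s : stalkC X ⟶ Z) : ofStalk s ≫ Z.d () () = 0 :=
  (s.comm () ()).trans zero_comp

lemma quasiIso_iff_up_to_refinements {K L : OnePeriodic A} (φ : K ⟶ L) :
    HomologicalComplex.quasiIso A oneShape φ ↔
      (∀ ⦃W : A⦄ (x : W ⟶ K.X ()) (_ : x ≫ K.d () () = 0) (y : W ⟶ L.X ())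
        (_ : x ≫ φ.f () = y ≫ L.d () ()),
        ∃ (W' : A) (π : W' ⟶ W) (_ : Epi π) (x' : W' ⟶ K.X ()), π ≫ x = x' ≫ K.d () ()) ∧
      (∀ ⦃W : A⦄ (y : W ⟶ L.X ()) (_ : y ≫ L.d () () = 0),
        ∃ (W' : A) (π : W' ⟶ W) (_ : Epi π) (x : W' ⟶ K.X ()) (_ : x ≫ K.d () () = 0)
          (z : W' ⟶ L.X ()), π ≫ y = x ≫ φ.f () + z ≫ L.d () ()) := by
  rw [HomologicalComplex.mem_quasiIso_iff]
  have h : QuasiIso φ ↔ Mono (HomologicalComplex.homologyMap φ ()) ∧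
      Epi (HomologicalComplex.homologyMap φ ()) := by
    constructor
    · intro h
      have : IsIso (HomologicalComplex.homologyMap φ ()) := inferInstance
      exact ⟨inferInstance, inferInstance⟩
    · rintro ⟨h₁, h₂⟩
      refine ⟨fun i => ?_⟩
      rw [quasiIsoAt_iff_isIso_homologyMap]
      cases i
      exact isIso_of_mono_of_epi _
  rw [h, HomologicalComplex.mono_homologyMap_iff_up_to_refinements φ () () () rfl rfl,
    HomologicalComplex.epi_homologyMap_iff_up_to_refinements φ () () () rfl rfl]

section Cone

variable {X Y : OnePeriodic A} (g : X ⟶ Y)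

/-- A generalized element of a mapping cone. -/
def cPair {W : A} (y : W ⟶ Y.X ()) (x : W ⟶ X.X ()) : W ⟶ (cone1 g).X () := biprod.lift y x

/-- A morphism from the underlying object of a mapping cone. -/
def cDesc {Z : A} (a : Y.X () ⟶ Z) (b : X.X () ⟶ Z) : (cone1 g).X () ⟶ Z := biprod.desc a b

variable {g}

lemma exists_eq_cPair {W : A} (z : W ⟶ (cone1 g).X ()) : ∃ y x, z = cPair g y x := by
  have h : ∀ z : W ⟶ Y.X () ⊞ X.X (), ∃ y x, z = biprod.lift y x := fun z =>
    ⟨z ≫ biprod.fst, z ≫ biprod.snd, by apply biprod.hom_ext <;> simp⟩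
  exact h z

lemma cPair_inj {W : A} {y y' : W ⟶ Y.X ()} {x x' : W ⟶ X.X ()} :
    cPair g y x = cPair g y' x' ↔ y = y' ∧ x = x' := by
  have h : biprod.lift y x = biprod.lift y' x' ↔ y = y' ∧ x = x' := by
    constructor
    · intro h
      exact ⟨by simpa using congr($h ≫ biprod.fst), by simpa using congr($h ≫ biprod.snd)⟩
    · rintro ⟨rfl, rfl⟩
      rfl
  exact h

lemma comp_cPair {W W' : A} (π : W' ⟶ W) (y : W ⟶ Y.X ()) (x : W ⟶ X.X ()) :
    π ≫ cPair g y x = cPair g (π ≫ y) (π ≫ x) := by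
  have h : π ≫ biprod.lift y x = biprod.lift (π ≫ y) (π ≫ x) :=
    biprod.hom_ext _ _ (by simp) (by simp)
  exact h

lemma cPair_add {W : A} (y y' : W ⟶ Y.X ()) (x x' : W ⟶ X.X ()) :
    cPair g y x + cPair g y' x' = cPair g (y + y') (x + x') := by
  have h : biprod.lift y x + biprod.lift y' x' = biprod.lift (y + y') (x + x') :=
    biprod.hom_ext _ _ (by simp) (by simp)
  exact h

lemma cPair_cDesc {W Z : A} (y : W ⟶ Y.X ()) (x : W ⟶ X.X ()) (a : Y.X () ⟶ Z)
    (b : X.X () ⟶ Z) : cPair g y x ≫ cDesc g a b = y ≫ a + x ≫ b :=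
  biprod.lift_desc

lemma cPair_zero {W : A} : cPair g (0 : W ⟶ Y.X ()) (0 : W ⟶ X.X ()) = 0 := by
  have h : biprod.lift (0 : W ⟶ Y.X ()) (0 : W ⟶ X.X ()) = 0 :=
    biprod.hom_ext _ _ (by simp) (by simp)
  exact h

lemma cPair_d {W : A} (y : W ⟶ Y.X ()) (x : W ⟶ X.X ()) :
    cPair g y x ≫ (cone1 g).d () () =
      cPair g (y ≫ Y.d () () + x ≫ g.f ()) (-(x ≫ X.d () ())) := by
  have h : biprod.lift y x ≫ biprod.desc (Y.d () () ≫ biprod.inl)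
      (g.f () ≫ biprod.inl - X.d () () ≫ biprod.inr) =
      biprod.lift (y ≫ Y.d () () + x ≫ g.f ()) (-(x ≫ X.d () ())) := by
    apply biprod.hom_ext <;> simp [biprod.lift_desc]
  exact h

lemma cone_hom_ext {Z : A} {a b : (cone1 g).X () ⟶ Z}
    (h : ∀ ⦃W : A⦄ (y : W ⟶ Y.X ()) (x : W ⟶ X.X ()), cPair g y x ≫ a = cPair g y x ≫ b) :
    a = b := by
  obtain ⟨y, x, h'⟩ := exists_eq_cPair (𝟙 ((cone1 g).X ()))
  rw [← Category.id_comp a, ← Category.id_comp b, h', h]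

end Cone

section StalkCone

variable {X : OnePeriodic A} {Y Z : A} {T : OnePeriodic A} (i : stalkC Y ⟶ T)

/-- A generalized element of the mapping cone of a morphism from a stalk complex. -/
def sPair {W : A} (y : W ⟶ T.X ()) (x : W ⟶ Y) : W ⟶ (cone1 i).X () := cPair i y x

/-- A morphism from the underlying object of the mapping cone of a morphism from a
stalk complex. -/
def sDesc (a : T.X () ⟶ Z) (b : Y ⟶ Z) : (cone1 i).X () ⟶ Z := cDesc i a b

variable {i}

lemma exists_eq_sPair {W : A} (z : W ⟶ (cone1 i).X ()) : ∃ y x, z = sPair i y x :=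
  exists_eq_cPair z

lemma sPair_inj {W : A} {y y' : W ⟶ T.X ()} {x x' : W ⟶ Y} :
    sPair i y x = sPair i y' x' ↔ y = y' ∧ x = x' := cPair_inj

lemma comp_sPair {W W' : A} (π : W' ⟶ W) (y : W ⟶ T.X ()) (x : W ⟶ Y) :
    π ≫ sPair i y x = sPair i (π ≫ y) (π ≫ x) := comp_cPair ..

lemma sPair_add {W : A} (y y' : W ⟶ T.X ()) (x x' : W ⟶ Y) :
    sPair i y x + sPair i y' x' = sPair i (y + y') (x + x') := cPair_add ..

lemma sPair_sDesc {W : A} (y : W ⟶ T.X ()) (x : W ⟶ Y) (a : T.X () ⟶ Z) (b : Y ⟶ Z) :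
    sPair i y x ≫ sDesc i a b = y ≫ a + x ≫ b := cPair_cDesc ..

lemma sPair_zero {W : A} : sPair i (0 : W ⟶ T.X ()) (0 : W ⟶ Y) = 0 := cPair_zero

lemma sPair_d {W : A} (y : W ⟶ T.X ()) (x : W ⟶ Y) :
    sPair i y x ≫ (cone1 i).d () () = sPair i (y ≫ T.d () () + x ≫ ofStalk i) 0 := by
  have h : ∀ x : W ⟶ (stalkC Y).X (), -(x ≫ (stalkC Y).d () ()) = 0 := fun x => by
    rw [neg_eq_zero]
    exact comp_zero
  exact (cPair_d (g := i) y x).trans (cPair_inj.2 ⟨rfl, h x⟩)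

lemma sCone_hom_ext {a b : (cone1 i).X () ⟶ Z}
    (h : ∀ ⦃W : A⦄ (y : W ⟶ T.X ()) (x : W ⟶ Y), sPair i y x ≫ a = sPair i y x ≫ b) :
    a = b := cone_hom_ext h

end StalkCone

section ConeToStalk

variable {Z : OnePeriodic A} {Y V : A} (g : Z ⟶ stalkC Y)

/-- A generalized element of the mapping cone of a morphism to a stalk complex. -/
def tPair {W : A} (y : W ⟶ Y) (x : W ⟶ Z.X ()) : W ⟶ (cone1 g).X () := cPair g y x

variable {g}

lemma exists_eq_tPair {W : A} (z : W ⟶ (cone1 g).X ()) : ∃ y x, z = tPair g y x :=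
  exists_eq_cPair z

lemma tPair_inj {W : A} {y y' : W ⟶ Y} {x x' : W ⟶ Z.X ()} :
    tPair g y x = tPair g y' x' ↔ y = y' ∧ x = x' := cPair_inj

lemma comp_tPair {W W' : A} (π : W' ⟶ W) (y : W ⟶ Y) (x : W ⟶ Z.X ()) :
    π ≫ tPair g y x = tPair g (π ≫ y) (π ≫ x) := comp_cPair ..

lemma tPair_add {W : A} (y y' : W ⟶ Y) (x x' : W ⟶ Z.X ()) :
    tPair g y x + tPair g y' x' = tPair g (y + y') (x + x') := cPair_add ..

lemma tPair_zero {W : A} : tPair g (0 : W ⟶ Y) (0 : W ⟶ Z.X ()) = 0 := cPair_zero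

lemma tPair_d {W : A} (y : W ⟶ Y) (x : W ⟶ Z.X ()) :
    tPair g y x ≫ (cone1 g).d () () = tPair g (x ≫ toStalk g) (-(x ≫ Z.d () ())) := by
  have h : ∀ y : W ⟶ (stalkC Y).X (), y ≫ (stalkC Y).d () () + x ≫ g.f () = x ≫ g.f () :=
    fun y => add_eq_right.2 comp_zero
  exact (cPair_d (g := g) y x).trans (cPair_inj.2 ⟨h y, rfl⟩)

end ConeToStalk

section ConeStalkHom

variable {P N Z : A} (j : P ⟶ N)

/-- A generalized element of the mapping cone of a morphism between stalk complexes. -/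
def jPair {W : A} (n : W ⟶ N) (k : W ⟶ P) : W ⟶ (cone1 (stalkHom j)).X () :=
  cPair (stalkHom j) n k

/-- A morphism from the underlying object of the mapping cone of a morphism between
stalk complexes. -/
def jDesc (a : N ⟶ Z) (b : P ⟶ Z) : (cone1 (stalkHom j)).X () ⟶ Z := cDesc (stalkHom j) a b

variable {j}

lemma exists_eq_jPair {W : A} (z : W ⟶ (cone1 (stalkHom j)).X ()) : ∃ n k, z = jPair j n k :=
  exists_eq_cPair z

lemma jPair_inj {W : A} {y y' : W ⟶ N} {x x' : W ⟶ P} :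
    jPair j y x = jPair j y' x' ↔ y = y' ∧ x = x' := cPair_inj

lemma comp_jPair {W W' : A} (π : W' ⟶ W) (y : W ⟶ N) (x : W ⟶ P) :
    π ≫ jPair j y x = jPair j (π ≫ y) (π ≫ x) := comp_cPair ..

lemma jPair_jDesc {W : A} (y : W ⟶ N) (x : W ⟶ P) (a : N ⟶ Z) (b : P ⟶ Z) :
    jPair j y x ≫ jDesc j a b = y ≫ a + x ≫ b := cPair_cDesc ..

lemma jPair_zero {W : A} : jPair j (0 : W ⟶ N) (0 : W ⟶ P) = 0 := cPair_zero

lemma jPair_d {W : A} (y : W ⟶ N) (x : W ⟶ P) :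
    jPair j y x ≫ (cone1 (stalkHom j)).d () () = jPair j (x ≫ j) 0 := by
  have h : ∀ n : W ⟶ (stalkC N).X (), n ≫ (stalkC N).d () () + x ≫ ofStalk (stalkHom j) =
      x ≫ j := fun n => add_eq_right.2 comp_zero
  exact (sPair_d (T := stalkC N) (i := stalkHom j) y x).trans (sPair_inj.2 ⟨h y, rfl⟩)

lemma jCone_hom_ext {a b : (cone1 (stalkHom j)).X () ⟶ Z}
    (h : ∀ ⦃W : A⦄ (y : W ⟶ N) (x : W ⟶ P), jPair j y x ≫ a = jPair j y x ≫ b) :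
    a = b := cone_hom_ext h

end ConeStalkHom

lemma quasiIso_toStalk_iff {X : A} {Z : OnePeriodic A} (s : Z ⟶ stalkC X) :
    HomologicalComplex.quasiIso A oneShape s ↔
      (∀ ⦃W : A⦄ (x : W ⟶ Z.X ()) (_ : x ≫ Z.d () () = 0) (_ : x ≫ toStalk s = 0),
        ∃ (W' : A) (π : W' ⟶ W) (_ : Epi π) (x' : W' ⟶ Z.X ()), π ≫ x = x' ≫ Z.d () ()) ∧
      (∀ ⦃W : A⦄ (y : W ⟶ X),
        ∃ (W' : A) (π : W' ⟶ W) (_ : Epi π) (x : W' ⟶ Z.X ()) (_ : x ≫ Z.d () () = 0),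
          π ≫ y = x ≫ toStalk s) := by
  rw [quasiIso_iff_up_to_refinements]
  constructor
  · rintro ⟨h₁, h₂⟩
    refine ⟨fun W x hx hx' => h₁ x hx 0 (hx'.trans zero_comp.symm), fun W y => ?_⟩
    obtain ⟨W', π, hπ, x, hx, z, hz⟩ := h₂ (W := W) y comp_zero
    have h : z ≫ (stalkC X).d () () = 0 := comp_zero
    rw [h, add_zero] at hz
    exact ⟨W', π, hπ, x, hx, hz⟩
  · rintro ⟨h₁, h₂⟩
    refine ⟨fun W x hx y hy => h₁ x hx (hy.trans comp_zero), fun W y _ => ?_⟩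
    obtain ⟨W', π, hπ, x, hx, hz⟩ := h₂ y
    refine ⟨W', π, hπ, x, hx, 0, hz.trans ?_⟩
    rw [zero_comp, add_zero]
    rfl

end OnePeriodic

end OnePeriodicAPI

section QuasiIsos

namespace OnePeriodic

variable {A : Type u} [Category.{v} A] [Abelian A]

/-- The morphism of mapping cones induced by precomposition. -/
def coneMap {V Z Y : OnePeriodic A} (t : V ⟶ Z) (g : Z ⟶ Y) : cone1 (t ≫ g) ⟶ cone1 g :=
  mkHom (cDesc (t ≫ g) (cPair g (𝟙 _) 0) (cPair g 0 (t.f ()))) (cone_hom_ext fun W y x => by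
    rw [← Category.assoc, ← Category.assoc, cPair_d]
    simp [cPair_cDesc, comp_cPair, cPair_add, cPair_d])

lemma cPair_coneMap {V Z Y : OnePeriodic A} (t : V ⟶ Z) (g : Z ⟶ Y) {W : A}
    (y : W ⟶ Y.X ()) (x : W ⟶ V.X ()) :
    cPair (t ≫ g) y x ≫ (coneMap t g).f () = cPair g y (x ≫ t.f ()) := by
  simp [coneMap, cPair_cDesc, comp_cPair, cPair_add]

lemma quasiIso_coneMap {V Z Y : OnePeriodic A} (t : V ⟶ Z) (g : Z ⟶ Y)
    (ht : HomologicalComplex.quasiIso A oneShape t) :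
    HomologicalComplex.quasiIso A oneShape (coneMap t g) := by
  rw [quasiIso_iff_up_to_refinements] at ht ⊢
  obtain ⟨h₁, h₂⟩ := ht
  constructor
  · intro W x hx y hxy
    obtain ⟨y₀, v, rfl⟩ := exists_eq_cPair x
    obtain ⟨y', z', rfl⟩ := exists_eq_cPair y
    rw [cPair_d, ← cPair_zero, cPair_inj] at hx
    rw [cPair_coneMap, cPair_d, cPair_inj] at hxy
    obtain ⟨hx₁, hx₂⟩ := hx
    obtain ⟨hy₁, hy₂⟩ := hxy
    obtain ⟨W₁, π₁, _, v', hv'⟩ := h₁ v (by simpa using hx₂) (-z') (by simpa using hy₂)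
    obtain ⟨W₂, π₂, _, v'', hv'', z'', hz''⟩ := h₂ (v' ≫ t.f () + π₁ ≫ z') (by
      rw [Preadditive.add_comp, Category.assoc, HomologicalComplex.Hom.comm,
        ← Category.assoc, ← hv', Category.assoc, Category.assoc, hy₂]
      simp)
    refine ⟨W₂, π₂ ≫ π₁, inferInstance,
      cPair _ (π₂ ≫ π₁ ≫ y' + z'' ≫ g.f ()) (v'' - π₂ ≫ v'), ?_⟩
    rw [comp_cPair, cPair_d, cPair_inj]
    constructor
    · have : z'' ≫ g.f () ≫ Y.d () () =
          (π₂ ≫ v' ≫ t.f () + π₂ ≫ π₁ ≫ z') ≫ g.f () - v'' ≫ t.f () ≫ g.f () := by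
        rw [HomologicalComplex.Hom.comm, ← Category.assoc, ← Category.assoc v'',
          ← Preadditive.sub_comp]
        congr 1
        rw [eq_sub_iff_add_eq, add_comm, ← hz'', Preadditive.comp_add]
      simp only [Category.assoc, hy₁, Preadditive.comp_add, Preadditive.add_comp, this,
        Preadditive.sub_comp, HomologicalComplex.comp_f]
      abel
    · simp [hv', hv'']
  · intro W y hy
    obtain ⟨y, z, rfl⟩ := exists_eq_cPair y
    rw [cPair_d, ← cPair_zero, cPair_inj] at hy
    obtain ⟨hy₁, hy₂⟩ := hy
    obtain ⟨W₁, π₁, _, v, hv, z', hz'⟩ := h₂ z (by simpa using hy₂)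
    have key : (π₁ ≫ y + z' ≫ g.f ()) ≫ Y.d () () + v ≫ t.f () ≫ g.f () = 0 := by
      have h := congr(π₁ ≫ $hy₁)
      rw [Preadditive.comp_add, ← Category.assoc π₁ z, hz', comp_zero] at h
      rw [← h]
      simp only [Preadditive.add_comp, Category.assoc, HomologicalComplex.Hom.comm]
      abel
    refine ⟨W₁, π₁, inferInstance, cPair _ (π₁ ≫ y + z' ≫ g.f ()) v, ?_, cPair _ 0 (-z'), ?_⟩
    · rw [cPair_d, ← cPair_zero, cPair_inj]
      exact ⟨key, by simp [hv]⟩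
    · rw [comp_cPair, cPair_coneMap, cPair_d, cPair_add, cPair_inj]
      constructor
      · simp
      · simpa using hz'

section Stalk

variable {X Y : A} {T : OnePeriodic A} (i : stalkC Y ⟶ T) (p : T ⟶ stalkC X)
  (w : ofStalk i ≫ toStalk p = 0)

/-- The morphism to a stalk complex from the cone of a morphism from a stalk complex. -/
def coneToStalk : cone1 i ⟶ stalkC X :=
  stalkDesc (sDesc i (toStalk p) 0) (sCone_hom_ext fun W y x => by
    rw [← Category.assoc, sPair_d, sPair_sDesc, Preadditive.add_comp, Category.assoc,
      Category.assoc, d_toStalk, w]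
    simp)

lemma sPair_coneToStalk {W : A} (y : W ⟶ T.X ()) (x : W ⟶ Y) :
    sPair i y x ≫ toStalk (coneToStalk i p w) = y ≫ toStalk p := by
  simp [coneToStalk, sPair_sDesc]

lemma quasiIso_coneToStalk (h : (ShortComplex.mk (ofStalk i) (toStalk p) w).ShortExact) :
    HomologicalComplex.quasiIso A oneShape (coneToStalk i p w) := by
  rw [quasiIso_toStalk_iff]
  have hmono : Mono (ofStalk i) := h.mono_f
  have hepi : Epi (toStalk p) := h.epi_g
  have hex := (ShortComplex.exact_iff_exact_up_to_refinements _).1 h.exact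
  dsimp at hex
  constructor
  · intro W x hx hxy
    obtain ⟨t, y₀, rfl⟩ := exists_eq_sPair x
    rw [sPair_d, ← sPair_zero, sPair_inj] at hx
    rw [sPair_coneToStalk] at hxy
    obtain ⟨W', π, _, y', hy'⟩ := hex t hxy
    have h₃ : π ≫ y₀ = 0 := by
      rw [← cancel_mono (ofStalk i), zero_comp]
      have := congr(π ≫ $(hx.1))
      rw [Preadditive.comp_add, ← Category.assoc, hy', Category.assoc, ofStalk_d] at this
      simpa using this
    refine ⟨W', π, inferInstance, sPair i 0 y', ?_⟩
    rw [comp_sPair, sPair_d, sPair_inj]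
    exact ⟨by simpa using hy', h₃⟩
  · intro W x
    obtain ⟨W₁, π₁, _, t, ht⟩ := surjective_up_to_refinements_of_epi (toStalk p) x
    obtain ⟨W₂, π₂, _, y, hy⟩ := hex (t ≫ T.d () ()) (by rw [Category.assoc, d_toStalk, comp_zero])
    refine ⟨W₂, π₂ ≫ π₁, inferInstance, sPair i (π₂ ≫ t) (-y), ?_, ?_⟩
    · rw [sPair_d, ← sPair_zero, sPair_inj]
      simp [hy]
    · simp [sPair_coneToStalk, ht]

/-- The projection from the cone of a morphism from a stalk complex to that complex. -/
def coneSnd : cone1 i ⟶ stalkC Y :=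
  stalkDesc (sDesc i 0 (𝟙 Y)) (sCone_hom_ext fun W y x => by
    rw [← Category.assoc, sPair_d, sPair_sDesc]
    simp)

lemma sPair_coneSnd {W : A} (y : W ⟶ T.X ()) (x : W ⟶ Y) :
    sPair i y x ≫ toStalk (coneSnd i) = x := by
  simp [coneSnd, sPair_sDesc]

end Stalk

/-- The complex with the opposite differential. -/
def negD (T : OnePeriodic A) : OnePeriodic A where
  X _ := T.X ()
  d _ _ := -T.d () ()
  shape _ _ h := absurd trivial h
  d_comp_d' := by intros; simp

/-- The homology does not depend on the sign of the differential. -/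
def homologyNegD (T : OnePeriodic A) : cohomology (negD T) ≅ cohomology T :=
  ShortComplex.homologyMapIso (S₁ := (negD T).sc ()) (S₂ := T.sc ())
    (ShortComplex.isoMk (S₁ := ShortComplex.mk (-T.d () ()) (-T.d () ()) (by simp))
      (S₂ := ShortComplex.mk (T.d () ()) (T.d () ()) (by simp))
      (-Iso.refl (T.X ())) (Iso.refl (T.X ())) (-Iso.refl (T.X ())) (by simp) (by simp))

/-- Constructor for morphisms from a complex with the opposite differential. -/
def negDDesc {T L : OnePeriodic A} (f : T.X () ⟶ L.X ())
    (h : f ≫ L.d () () = -(T.d () () ≫ f)) : negD T ⟶ L :=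
  mkHom (K := negD T) f (h.trans (Preadditive.neg_comp _ _).symm)

lemma quasiIso_negDDesc {T L : OnePeriodic A} (f : T.X () ⟶ L.X ())
    (h : f ≫ L.d () () = -(T.d () () ≫ f))
    (h₁ : ∀ ⦃W : A⦄ (x : W ⟶ T.X ()) (_ : x ≫ T.d () () = 0) (y : W ⟶ L.X ())
      (_ : x ≫ f = y ≫ L.d () ()),
      ∃ (W' : A) (π : W' ⟶ W) (_ : Epi π) (x' : W' ⟶ T.X ()), π ≫ x = x' ≫ T.d () ())
    (h₂ : ∀ ⦃W : A⦄ (y : W ⟶ L.X ()) (_ : y ≫ L.d () () = 0),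
      ∃ (W' : A) (π : W' ⟶ W) (_ : Epi π) (x : W' ⟶ T.X ()) (_ : x ≫ T.d () () = 0)
        (z : W' ⟶ L.X ()), π ≫ y = x ≫ f + z ≫ L.d () ()) :
    HomologicalComplex.quasiIso A oneShape (negDDesc f h) := by
  have hd : ∀ {W : A} (x : W ⟶ T.X ()), x ≫ (negD T).d () () = -(x ≫ T.d () ()) :=
    fun x => Preadditive.comp_neg x (T.d () ())
  rw [quasiIso_iff_up_to_refinements]
  constructor
  · intro W x hx y hy
    obtain ⟨W', π, hπ, x', hx'⟩ := h₁ x (neg_eq_zero.1 ((hd x).symm.trans hx)) y hy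
    exact ⟨W', π, hπ, -x', (hx'.trans ((hd (-x')).trans (neg_eq_iff_eq_neg.2 (Preadditive.neg_comp x' _))).symm)⟩
  · intro W y hy
    obtain ⟨W', π, hπ, x, hx, z, hz⟩ := h₂ y hy
    exact ⟨W', π, hπ, x, (hd x).trans (neg_eq_zero.2 hx), z, hz⟩

/-- The inclusion of a complex, with the opposite differential, in the cone of the
projection `coneSnd i`. -/
def toConeConeSnd {Y : A} {T : OnePeriodic A} (i : stalkC Y ⟶ T) :
    negD T ⟶ cone1 (coneSnd i) :=
  negDDesc (tPair (coneSnd i) 0 (sPair i (𝟙 (T.X ())) 0)) (by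
    rw [tPair_d, sPair_d, comp_tPair, sPair_coneSnd, comp_sPair, eq_neg_iff_add_eq_zero, tPair_add,
      ← tPair_zero, tPair_inj]
    constructor
    · simp
    · rw [neg_add_eq_zero, sPair_inj]
      simp)

lemma quasiIso_toConeConeSnd {Y : A} {T : OnePeriodic A} (i : stalkC Y ⟶ T) :
    HomologicalComplex.quasiIso A oneShape (toConeConeSnd i) := by
  apply quasiIso_negDDesc
  · intro W x _ y hy
    obtain ⟨y', z, rfl⟩ := exists_eq_tPair y
    obtain ⟨e', y, rfl⟩ := exists_eq_sPair z
    rw [comp_tPair, tPair_d, tPair_inj, sPair_d, sPair_coneSnd, comp_sPair,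
      eq_neg_iff_add_eq_zero, sPair_add, ← sPair_zero, sPair_inj] at hy
    obtain ⟨h₁, h₂, -⟩ := hy
    rw [← h₁] at h₂
    refine ⟨W, 𝟙 W, inferInstance, -e', ?_⟩
    rw [Category.id_comp, Preadditive.neg_comp, eq_neg_iff_add_eq_zero]
    simpa using h₂
  · intro W y hy
    obtain ⟨y', z, rfl⟩ := exists_eq_tPair y
    obtain ⟨e, y, rfl⟩ := exists_eq_sPair z
    rw [tPair_d, ← tPair_zero, tPair_inj, sPair_d, sPair_coneSnd, neg_eq_zero, ← sPair_zero,
      sPair_inj] at hy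
    obtain ⟨rfl, h₂, -⟩ := hy
    refine ⟨W, 𝟙 W, inferInstance, e + y' ≫ ofStalk i, ?_, tPair _ 0 (sPair i 0 y'), ?_⟩
    · rw [zero_comp, add_zero] at h₂
      simp [h₂, ofStalk_d]
    · rw [Category.id_comp, comp_tPair, tPair_d, tPair_add, tPair_inj, sPair_d, sPair_coneSnd, comp_sPair,
        eq_add_neg_iff_add_eq, sPair_add, sPair_inj]
      simp

end OnePeriodic

end QuasiIsos

section Resolution

namespace OnePeriodic

variable {A : Type u} [Category.{v} A] [Abelian A]

/-- The morphism to `Z` from the cone of a morphism `j : P ⟶ N` between stalk complexes. -/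
def ofConeStalkHom {Z : OnePeriodic A} {P N : A} (j : P ⟶ N) (φ : N ⟶ Z.X ())
    (hφ : φ ≫ Z.d () () = 0) (u : P ⟶ Z.X ()) (hu : j ≫ φ = u ≫ Z.d () ()) :
    cone1 (stalkHom j) ⟶ Z :=
  mkHom (jDesc j φ u) (jCone_hom_ext fun W n k => by
    rw [← Category.assoc, jPair_jDesc, ← Category.assoc, jPair_d, jPair_jDesc]
    simp [hφ, hu])

lemma jPair_ofConeStalkHom {Z : OnePeriodic A} {P N : A} (j : P ⟶ N) (φ : N ⟶ Z.X ())
    (hφ : φ ≫ Z.d () () = 0) (u : P ⟶ Z.X ()) (hu : j ≫ φ = u ≫ Z.d () ())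
    {W : A} (n : W ⟶ N) (k : W ⟶ P) :
    jPair j n k ≫ (ofConeStalkHom j φ hφ u hu).f () = n ≫ φ + k ≫ u :=
  jPair_jDesc n k φ u

lemma exists_resolution [HasExt.{w} A] {Z : OnePeriodic A} {H P : A}
    (hHered : ∀ Y : A, Subsingleton (Abelian.Ext H Y 2))
    (q : kernel (Z.d () ()) ⟶ H) [Epi q]
    (hq : kernel.lift (Z.d () ()) (Z.d () ()) Z.d_sq ≫ q = 0) (u : P ⟶ Z.X ())
    (hu : ∀ ⦃W : A⦄ (c : W ⟶ kernel (Z.d () ())), c ≫ q = 0 →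
      ∃ (W' : A) (π : W' ⟶ W) (_ : Epi π) (x : W' ⟶ P),
        π ≫ c ≫ kernel.ι (Z.d () ()) = x ≫ u ≫ Z.d () ()) :
    ∃ (N : A) (j : P ⟶ N) (r : N ⟶ H) (w : j ≫ r = 0) (_ : (ShortComplex.mk j r w).ShortExact)
      (φ : N ⟶ kernel (Z.d () ())) (_ : φ ≫ q = r)
      (hφ : (φ ≫ kernel.ι (Z.d () ())) ≫ Z.d () () = 0)
      (h : j ≫ φ ≫ kernel.ι (Z.d () ()) = u ≫ Z.d () ()),
      HomologicalComplex.quasiIso A oneShape (ofConeStalkHom j _ hφ u h) := by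
  let κ := kernel.ι (Z.d () ())
  have hκ : κ ≫ Z.d () () = 0 := kernel.condition _
  let δ := kernel.lift (Z.d () ()) (Z.d () ()) Z.d_sq
  have hδ : δ ≫ κ = Z.d () () := kernel.lift_ι _ _ _
  let e : P ⟶ kernel q := kernel.lift q (u ≫ δ) (by rw [Category.assoc, hq, comp_zero])
  have he : e ≫ kernel.ι q = u ≫ δ := kernel.lift_ι _ _ _
  have : Epi e := by
    rw [epi_iff_surjective_up_to_refinements]
    intro W c
    obtain ⟨W', π, hπ, x, hx⟩ := hu (c ≫ kernel.ι q) (by simp)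
    refine ⟨W', π, hπ, x, ?_⟩
    rw [← cancel_mono (kernel.ι q), ← cancel_mono κ, Category.assoc, Category.assoc,
      ← Category.assoc c, hx, Category.assoc x, he, Category.assoc, Category.assoc, hδ]
  have hS : (ShortComplex.mk (kernel.ι q) q (kernel.condition q)).ShortExact :=
    { exact := ShortComplex.exact_kernel q
      mono_f := by dsimp; infer_instance
      epi_g := by assumption }
  have : Subsingleton (Abelian.Ext (ShortComplex.mk (kernel.ι q) q (kernel.condition q)).X₃
    (kernel e) 2) := hHered _
  obtain ⟨N, j, r, w, hN, φ, hφ₁, hφ₂⟩ : ∃ (N : A) (j : P ⟶ N) (r : N ⟶ H) (w : j ≫ r = 0)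
    (_ : (ShortComplex.mk j r w).ShortExact) (φ : N ⟶ kernel (Z.d () ())),
      j ≫ φ = e ≫ kernel.ι q ∧ φ ≫ q = r := hS.exists_lift e
  rw [he] at hφ₁
  have hφ : (φ ≫ κ) ≫ Z.d () () = 0 := by rw [Category.assoc, hκ, comp_zero]
  have h : j ≫ φ ≫ κ = u ≫ Z.d () () := by rw [reassoc_of% hφ₁, hδ]
  refine ⟨N, j, r, w, hN, φ, hφ₂, hφ, h, ?_⟩
  have hmono : Mono j := hN.mono_f
  have hepi : Epi r := hN.epi_g
  have hex := (ShortComplex.exact_iff_exact_up_to_refinements _).1 hN.exact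
  dsimp at hex
  rw [quasiIso_iff_up_to_refinements]
  constructor
  · intro W x hx y hxy
    obtain ⟨n, k, rfl⟩ := exists_eq_jPair x
    rw [jPair_d, ← jPair_zero, jPair_inj] at hx
    have hk : k = 0 := by
      rw [← cancel_mono j, zero_comp]
      exact hx.1
    rw [jPair_ofConeStalkHom, hk, zero_comp, add_zero] at hxy
    have hn : n ≫ r = 0 := by
      have : n ≫ φ = y ≫ δ := by
        rw [← cancel_mono κ, Category.assoc, Category.assoc, hδ]
        exact hxy
      rw [← hφ₂, reassoc_of% this, hq, comp_zero]
    obtain ⟨W', π, hπ, k', hk'⟩ := hex n hn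
    refine ⟨W', π, hπ, jPair j 0 k', ?_⟩
    rw [comp_jPair, jPair_d, jPair_inj]
    exact ⟨hk', by rw [hk, comp_zero]⟩
  · intro W z hz
    let c := kernel.lift _ z hz
    have hc : c ≫ κ = z := kernel.lift_ι _ _ _
    obtain ⟨W₁, π₁, _, n, hn⟩ := surjective_up_to_refinements_of_epi r (c ≫ q)
    obtain ⟨W₂, π₂, _, x, hx⟩ := hu (π₁ ≫ c - n ≫ φ) (by
      rw [Preadditive.sub_comp, Category.assoc, hn, Category.assoc, hφ₂, sub_self])
    refine ⟨W₂, π₂ ≫ π₁, inferInstance, jPair j (π₂ ≫ n) 0, ?_, x ≫ u, ?_⟩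
    · rw [jPair_d, ← jPair_zero, jPair_inj]
      exact ⟨zero_comp, rfl⟩
    · rw [jPair_ofConeStalkHom, Category.assoc, Category.assoc x, ← hx, zero_comp, add_zero,
        Preadditive.sub_comp, Preadditive.comp_sub, Category.assoc, Category.assoc, hc]
      simp

end OnePeriodic

end Resolution

section Fractions

namespace OnePeriodic

variable {A : Type u} [Category.{v} A] [Abelian A]

/-- Constructor for homotopies between morphisms of `1`-periodic complexes. -/
def mkHomotopy {K L : OnePeriodic A} {a b : K ⟶ L} (h : K.X () ⟶ L.X ())
    (comm : a.f () = K.d () () ≫ h + h ≫ L.d () () + b.f ()) : Homotopy a b where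
  hom _ _ := h
  zero _ _ hij := absurd trivial hij
  comm _ := by
    rw [dNext_eq (c := oneShape) _ (i := ()) (i' := ()) trivial,
      prevD_eq (c := oneShape) _ (j := ()) (j' := ()) trivial]
    exact comm

instance : oneShape.QFactorsThroughHomotopy A :=
  ComplexShape.QFactorsThroughHomotopy_of_exists_prev (c := oneShape) (fun _ => ⟨(), trivial⟩) A

section Ore

variable {V Z Y : OnePeriodic A} (s : V ⟶ Y) (g : Z ⟶ Y)

/-- The morphism to a mapping cone induced by a morphism to the target. -/
def toCone : Z ⟶ cone1 s :=
  mkHom (cPair s (g.f ()) 0) (by rw [cPair_d, comp_cPair]; simp)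

lemma comp_toCone {W : A} (z : W ⟶ Z.X ()) : z ≫ (toCone s g).f () = cPair s (z ≫ g.f ()) 0 :=
  (comp_cPair (g := s) _ _ _).trans (by rw [comp_zero])

/-- The first projection from the homotopy pullback. -/
def orePr₁ : negD (cone1 (toCone s g)) ⟶ Z :=
  negDDesc (cDesc _ 0 (𝟙 _)) (cone_hom_ext fun W y x => by
    rw [Preadditive.comp_neg, ← Category.assoc, ← Category.assoc, cPair_d, cPair_cDesc,
      cPair_cDesc]
    simp)

/-- The second projection from the homotopy pullback. -/
def orePr₂ : negD (cone1 (toCone s g)) ⟶ V :=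
  negDDesc (cDesc _ (cDesc s 0 (-𝟙 _)) 0) (cone_hom_ext fun W y x => by
    obtain ⟨y, v, rfl⟩ := exists_eq_cPair y
    simp only [Preadditive.comp_neg, ← Category.assoc, cPair_d, cPair_cDesc, comp_toCone, cPair_add]
    simp)

/-- The square given by the homotopy pullback commutes up to homotopy. -/
def oreHomotopy : Homotopy (orePr₁ s g ≫ g) (orePr₂ s g ≫ s) :=
  mkHomotopy (K := negD (cone1 (toCone s g))) (cDesc (toCone s g) (-cDesc s (𝟙 _) 0) 0) (by
    have key : cDesc (toCone s g) 0 (𝟙 _) ≫ g.f () =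
        (-(cone1 (toCone s g)).d () ()) ≫ cDesc (toCone s g) (-cDesc s (𝟙 _) 0) 0 +
          cDesc (toCone s g) (-cDesc s (𝟙 _) 0) 0 ≫ Y.d () () +
          cDesc (toCone s g) (cDesc s 0 (-𝟙 _)) 0 ≫ s.f () := by
      apply cone_hom_ext
      intro W y z
      obtain ⟨y, v, rfl⟩ := exists_eq_cPair y
      simp only [Preadditive.neg_comp, Preadditive.comp_add, Preadditive.comp_neg]
      simp only [← Category.assoc, cPair_d, cPair_cDesc, comp_toCone, cPair_add]
      simp only [Preadditive.comp_neg, cPair_cDesc]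
      simp
      abel
    exact key)

lemma quasiIso_orePr₁ (hs : HomologicalComplex.quasiIso A oneShape s) :
    HomologicalComplex.quasiIso A oneShape (orePr₁ s g) := by
  rw [quasiIso_iff_up_to_refinements] at hs
  obtain ⟨h₁, h₂⟩ := hs
  apply quasiIso_negDDesc
  · intro W x hx z' hz'
    obtain ⟨y, z, rfl⟩ := exists_eq_cPair x
    obtain ⟨y, v, rfl⟩ := exists_eq_cPair y
    rw [cPair_d, ← cPair_zero, cPair_inj, cPair_d, comp_toCone, cPair_add, ← cPair_zero,
      cPair_inj] at hx
    obtain ⟨⟨hx₁, hx₂⟩, -⟩ := hx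
    replace hx₂ : v ≫ V.d () () = 0 := by simpa using hx₂
    replace hz' : z = z' ≫ Z.d () () := by simpa [cPair_cDesc] using hz'
    obtain rfl := hz'
    obtain ⟨W₁, π₁, _, v', hv'⟩ := h₁ v hx₂ (-(y + z' ≫ g.f ())) (by
      rw [Preadditive.neg_comp, eq_neg_iff_add_eq_zero, ← hx₁]
      simp only [Preadditive.add_comp, Category.assoc, HomologicalComplex.Hom.comm]
      abel)
    obtain ⟨W₂, π₂, _, v'', hv'', y', hy'⟩ := h₂ (v' ≫ s.f () + π₁ ≫ (y + z' ≫ g.f ())) (by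
      rw [Preadditive.add_comp, Category.assoc, HomologicalComplex.Hom.comm,
        ← Category.assoc v', ← hv', Category.assoc, Category.assoc, ← Preadditive.comp_add,
        Preadditive.add_comp, Category.assoc z', HomologicalComplex.Hom.comm]
      rw [← comp_zero (f := π₁), ← hx₁]
      simp only [Category.assoc, Preadditive.comp_add]
      abel)
    refine ⟨W₂, π₂ ≫ π₁, inferInstance,
      cPair _ (cPair _ y' (v'' - π₂ ≫ v')) (-(π₂ ≫ π₁ ≫ z')), ?_⟩
    have hy'' : y' ≫ Y.d () () = π₂ ≫ (v' ≫ s.f () + π₁ ≫ (y + z' ≫ g.f ())) - v'' ≫ s.f () := by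
      rw [hy', add_sub_cancel_left]
    rw [comp_cPair, comp_cPair, cPair_d, cPair_d, comp_toCone, cPair_add, cPair_inj, cPair_inj,
      hy'']
    refine ⟨⟨?_, ?_⟩, ?_⟩
    · simp only [Category.assoc, Preadditive.comp_add, Preadditive.sub_comp, Preadditive.neg_comp]
      abel
    · simp [hv', hv'']
    · simp
  · intro W z hz
    obtain ⟨W₁, π₁, _, v, hv, y, hy⟩ := h₂ (z ≫ g.f ()) (by
      rw [Category.assoc, HomologicalComplex.Hom.comm, reassoc_of% hz, zero_comp])
    refine ⟨W₁, π₁, inferInstance, cPair _ (cPair _ (-y) (-v)) (π₁ ≫ z), ?_, 0, ?_⟩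
    · rw [cPair_d, cPair_d, comp_toCone, cPair_add, ← cPair_zero, cPair_inj, ← cPair_zero,
        cPair_inj]
      refine ⟨⟨?_, ?_⟩, ?_⟩
      · rw [Category.assoc, hy]
        simp only [Preadditive.neg_comp]
        abel
      · simp [hv]
      · simp [hz]
    · simp [cPair_cDesc]

end Ore

variable [MorphismProperty.HasLocalization.{w'} (HomologicalComplex.quasiIso A oneShape)]

lemma isIso_QD_map {K L : OnePeriodic A} (s : K ⟶ L)
    (hs : HomologicalComplex.quasiIso A oneShape s) :
    IsIso (QD.map s) :=
  Localization.inverts QD (HomologicalComplex.quasiIso A oneShape) s hs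

end OnePeriodic

end Fractions

section Formality

namespace OnePeriodic

variable {A : Type u} [Category.{v} A] [Abelian A]
  [MorphismProperty.HasLocalization.{w'} (HomologicalComplex.quasiIso A oneShape)]

lemma nonempty_iso_of_quasiIso {K L : OnePeriodic A} (s : K ⟶ L)
    (hs : HomologicalComplex.quasiIso A oneShape s) : Nonempty (QD.obj K ≅ QD.obj L) :=
  have := isIso_QD_map s hs
  ⟨asIso (QD.map s)⟩

lemma nonempty_cohomology_iso {K L : OnePeriodic A} (e : QD.obj K ≅ QD.obj L) :
    Nonempty (cohomology K ≅ cohomology L) :=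
  ⟨((HomologicalComplexUpToQuasiIso.homologyFunctorFactors A oneShape ()).app K).symm ≪≫
    (HomologicalComplexUpToQuasiIso.homologyFunctor A oneShape ()).mapIso e ≪≫
    (HomologicalComplexUpToQuasiIso.homologyFunctorFactors A oneShape ()).app L⟩

/-- The cohomology of a stalk complex. -/
def cohomologyStalkC (M : A) : cohomology (stalkC M) ≅ M :=
  (ShortComplex.HomologyData.ofZeros ((stalkC M).sc ()) rfl rfl).left.homologyIso

/-- An isomorphism of stalk complexes. -/
def stalkCIso {M N : A} (e : M ≅ N) : stalkC M ≅ stalkC N where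
  hom := stalkHom e.hom
  inv := stalkHom e.inv
  hom_inv_id := hom_ext e.hom_inv_id
  inv_hom_id := hom_ext e.inv_hom_id

lemma nonempty_iso_stalkC_cohomology [HasExt.{w} A]
    (hHered : ∀ X Y : A, Subsingleton (Abelian.Ext X Y 2)) (K : OnePeriodic A) :
    Nonempty (QD.obj K ≅ QD.obj (stalkC (cohomology K))) := by
  suffices ∃ H : A, Nonempty (QD.obj K ≅ QD.obj (stalkC H)) by
    obtain ⟨H, ⟨e⟩⟩ := this
    obtain ⟨e'⟩ := nonempty_cohomology_iso e
    exact ⟨e ≪≫ QD.mapIso (stalkCIso (e' ≪≫ cohomologyStalkC H).symm)⟩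
  let δ := kernel.lift (K.d () ()) (K.d () ()) K.d_sq
  have hδ : δ ≫ kernel.ι (K.d () ()) = K.d () () := kernel.lift_ι _ _ _
  have hex := (ShortComplex.exact_iff_exact_up_to_refinements _).1
    (ShortComplex.exact_cokernel δ)
  dsimp at hex
  obtain ⟨N, j, r, w, hN, φ, hr, hφ, h, hv⟩ := exists_resolution (Z := K) (fun Y => hHered _ Y)
    (cokernel.π δ) (cokernel.condition δ) (𝟙 (K.X ())) (fun W c hc => by
      obtain ⟨W', π, hπ, x, hx⟩ := hex c hc
      exact ⟨W', π, hπ, x, by rw [reassoc_of% hx, hδ, Category.id_comp]⟩)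
  obtain ⟨e₁⟩ := nonempty_iso_of_quasiIso _ hv
  obtain ⟨e₂⟩ := nonempty_iso_of_quasiIso _
    (quasiIso_coneToStalk (stalkHom j) (stalkHom r) w hN)
  exact ⟨_, ⟨e₁.symm ≪≫ e₂⟩⟩

lemma nonempty_iso_stalkC_iff [HasExt.{w} A]
    (hHered : ∀ X Y : A, Subsingleton (Abelian.Ext X Y 2)) (K : OnePeriodic A) (M : A) :
    Nonempty (QD.obj K ≅ QD.obj (stalkC M)) ↔ Nonempty (cohomology K ≅ M) := by
  constructor
  · rintro ⟨e⟩
    obtain ⟨e'⟩ := nonempty_cohomology_iso e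
    exact ⟨e' ≪≫ cohomologyStalkC M⟩
  · rintro ⟨e⟩
    obtain ⟨e'⟩ := nonempty_iso_stalkC_cohomology hHered K
    exact ⟨e' ≪≫ QD.mapIso (stalkCIso e)⟩

end OnePeriodic

end Formality

section ExtensionData

open OnePeriodic

variable {A : Type u} [Category.{v} A] [Abelian A]

/-- An extension of `X` by `Y` in `A` together with a morphism `X ⟶ Y`: this is the
datum of an extension of the stalk complex of `X` by the stalk complex of `Y`. -/
structure StalkExtension (X Y : A) where
  /-- the middle term -/
  E : A
  /-- the inclusion -/
  i : Y ⟶ E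
  /-- the projection -/
  p : E ⟶ X
  w : i ≫ p = 0
  shortExact : (ShortComplex.mk i p w).ShortExact
  /-- the morphism inducing the differential -/
  f : X ⟶ Y

namespace StalkExtension

variable {X Y : A} (a : StalkExtension X Y)

/-- The middle term of the extension of stalk complexes. -/
def middle : OnePeriodic A where
  X _ := a.E
  d _ _ := a.p ≫ a.f ≫ a.i
  shape _ _ h := absurd trivial h
  d_comp_d' := by intros; simp [reassoc_of% a.w]

/-- The inclusion in the extension of stalk complexes. -/
def ι : stalkC Y ⟶ a.middle :=
  stalkLift (Z := a.middle) a.i ((reassoc_of% a.w) _ |>.trans zero_comp)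

/-- The projection in the extension of stalk complexes. -/
def π : a.middle ⟶ stalkC X :=
  have h : (a.p ≫ a.f ≫ a.i) ≫ a.p = 0 := by simp [a.w]
  stalkDesc (Z := a.middle) a.p h

/-- The cone of `a.ι` is quasi-isomorphic to the stalk complex of `X`. -/
def s : cone1 a.ι ⟶ stalkC X := coneToStalk a.ι a.π a.w

lemma quasiIso_s : HomologicalComplex.quasiIso A oneShape a.s :=
  quasiIso_coneToStalk a.ι a.π a.w a.shortExact

/-- The projection from the cone of `a.ι` to the stalk complex of `Y`. -/
def g : cone1 a.ι ⟶ stalkC Y := coneSnd a.ι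

/-- A generalized element of the cone of `a.ι`. -/
def pair {W : A} (e : W ⟶ a.E) (y : W ⟶ Y) : W ⟶ (cone1 a.ι).X () := sPair a.ι e y

variable {a}

lemma exists_eq_pair {W : A} (z : W ⟶ (cone1 a.ι).X ()) : ∃ e y, z = a.pair e y :=
  exists_eq_sPair z

lemma pair_inj {W : A} {y y' : W ⟶ a.E} {x x' : W ⟶ Y} :
    a.pair y x = a.pair y' x' ↔ y = y' ∧ x = x' := sPair_inj

lemma comp_pair {W W' : A} (π : W' ⟶ W) (y : W ⟶ a.E) (x : W ⟶ Y) :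
    π ≫ a.pair y x = a.pair (π ≫ y) (π ≫ x) := comp_sPair ..

lemma pair_add {W : A} (y y' : W ⟶ a.E) (x x' : W ⟶ Y) :
    a.pair y x + a.pair y' x' = a.pair (y + y') (x + x') := sPair_add ..

lemma pair_d {W : A} (y : W ⟶ a.E) (x : W ⟶ Y) :
    a.pair y x ≫ (cone1 a.ι).d () () = a.pair (y ≫ a.p ≫ a.f ≫ a.i + x ≫ a.i) 0 := sPair_d ..

lemma pair_s {W : A} (y : W ⟶ a.E) (x : W ⟶ Y) : a.pair y x ≫ toStalk a.s = y ≫ a.p :=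
  sPair_coneToStalk ..

lemma pair_g {W : A} (y : W ⟶ a.E) (x : W ⟶ Y) : a.pair y x ≫ toStalk a.g = x :=
  sPair_coneSnd (T := a.middle) ..

variable (a) in
/-- A morphism from the cone of `a.ι`. -/
def pairDesc {Z : A} (c : a.E ⟶ Z) (d : Y ⟶ Z) : (cone1 a.ι).X () ⟶ Z := sDesc a.ι c d

lemma pair_pairDesc {W Z : A} (y : W ⟶ a.E) (x : W ⟶ Y) (c : a.E ⟶ Z) (d : Y ⟶ Z) :
    a.pair y x ≫ a.pairDesc c d = y ≫ c + x ≫ d := sPair_sDesc ..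

lemma cone_ι_hom_ext {Z : A} {c d : (cone1 a.ι).X () ⟶ Z}
    (h : ∀ ⦃W : A⦄ (y : W ⟶ a.E) (x : W ⟶ Y), a.pair y x ≫ c = a.pair y x ≫ d) : c = d :=
  sCone_hom_ext h

/-- The morphism between cones induced by a morphism of extensions. -/
def coneHom {b : StalkExtension X Y} (θ : a.E ⟶ b.E) (h₁ : a.i ≫ θ = b.i) (h₂ : θ ≫ b.p = a.p)
    (hf : a.f = b.f) : cone1 a.ι ⟶ cone1 b.ι :=
  mkHom (a.pairDesc (b.pair θ 0) (b.pair 0 (𝟙 Y))) (cone_ι_hom_ext fun W y x => by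
    rw [← Category.assoc, ← Category.assoc, pair_d, pair_pairDesc, pair_pairDesc, comp_pair,
      comp_pair, comp_pair, comp_pair, pair_add, pair_add, pair_d, pair_inj]
    simp [reassoc_of% h₂, h₁, hf])

variable [MorphismProperty.HasLocalization.{w'} (HomologicalComplex.quasiIso A oneShape)]

variable (a) in
/-- The morphism in the derived category attached to an extension of stalk complexes. -/
def toHom : QD.obj (stalkC X) ⟶ QD.obj (stalkC Y) :=
  have := isIso_QD_map a.s a.quasiIso_s
  inv (QD.map a.s) ≫ QD.map a.g

lemma map_s_toHom : QD.map a.s ≫ a.toHom = QD.map a.g := by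
  have := isIso_QD_map a.s a.quasiIso_s
  simp [toHom]

lemma eq_toHom (φ : QD.obj (stalkC X) ⟶ QD.obj (stalkC Y))
    (h : QD.map a.s ≫ φ = QD.map a.g) : a.toHom = φ := by
  have := isIso_QD_map a.s a.quasiIso_s
  rw [← cancel_epi (QD.map a.s), map_s_toHom, h]

lemma nonempty_cone_g_iso_iff [HasExt.{w} A]
    (hHered : ∀ X Y : A, Subsingleton (Abelian.Ext X Y 2)) (M : A) :
    Nonempty (QD.obj (cone1 a.g) ≅ QD.obj (stalkC M)) ↔ Nonempty (cohomology a.middle ≅ M) := by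
  obtain ⟨e⟩ := nonempty_iso_of_quasiIso _ (quasiIso_toConeConeSnd a.ι)
  obtain ⟨e'⟩ := nonempty_cohomology_iso e
  rw [nonempty_iso_stalkC_iff hHered]
  constructor
  · rintro ⟨h⟩
    exact ⟨(homologyNegD a.middle).symm ≪≫ e' ≪≫ h⟩
  · rintro ⟨h⟩
    exact ⟨e'.symm ≪≫ homologyNegD a.middle ≪≫ h⟩

lemma exists_of_fraction [HasExt.{w} A]
    (hHered : ∀ X Y : A, Subsingleton (Abelian.Ext X Y 2))
    (φ : QD.obj (stalkC X) ⟶ QD.obj (stalkC Y)) {Z : OnePeriodic A} (s : Z ⟶ stalkC X)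
    (g : Z ⟶ stalkC Y) (hs : HomologicalComplex.quasiIso A oneShape s)
    (h : QD.map s ≫ φ = QD.map g) :
    ∃ (a : StalkExtension X Y), a.toHom = φ ∧
      Nonempty (QD.obj (cone1 g) ≅ QD.obj (cone1 a.g)) := by
  have hs' := hs
  rw [quasiIso_toStalk_iff] at hs'
  obtain ⟨h₁, h₂⟩ := hs'
  let q : kernel (Z.d () ()) ⟶ X := kernel.ι _ ≫ toStalk s
  have : Epi q := by
    rw [epi_iff_surjective_up_to_refinements]
    intro W y
    obtain ⟨W', π, hπ, x, hx, hxy⟩ := h₂ y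
    exact ⟨W', π, hπ, kernel.lift _ x hx, by simpa [q] using hxy⟩
  obtain ⟨N, j, r, w, hN, φ', hr, hφ, hj, hv⟩ := exists_resolution (Z := Z)
    (fun Y => hHered _ Y) q (by simp [q, d_toStalk]) (kernel.ι (toStalk s)) (fun W c hc => by
      obtain ⟨W₁, π₁, _, x, hx⟩ := h₁ (c ≫ kernel.ι _) (by simp) (by simpa [q] using hc)
      obtain ⟨W₂, π₂, _, x', hx', hxx'⟩ := h₂ (x ≫ toStalk s)
      refine ⟨W₂, π₂ ≫ π₁, inferInstance, kernel.lift _ (π₂ ≫ x - x') (by simp [hxx']), ?_⟩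
      simp [hx, hx'])
  let n := φ' ≫ kernel.ι (Z.d () ())
  have hns : n ≫ toStalk s = r := by simpa [n, q] using hr
  have hjn : j ≫ n = kernel.ι (toStalk s) ≫ Z.d () () := hj
  have : Epi r := hN.epi_g
  let f₀ : X ⟶ Y := hN.exact.desc (n ≫ toStalk g) (by
    dsimp
    rw [reassoc_of% hjn, d_toStalk, comp_zero])
  have hf₀ : r ≫ f₀ = n ≫ toStalk g := hN.exact.g_desc _ _
  let gK := kernel.ι (toStalk s) ≫ toStalk g
  obtain ⟨E, i, p, w', hE, ψ, hψ₁, hψ₂⟩ : ∃ (E : A) (i : Y ⟶ E) (p : E ⟶ X) (w : i ≫ p = 0)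
    (_ : (ShortComplex.mk i p w).ShortExact) (ψ : N ⟶ E), j ≫ ψ = gK ≫ i ∧ ψ ≫ p = r :=
      hN.exists_pushout gK
  let a : StalkExtension X Y := ⟨E, i, p, w', hE, -f₀⟩
  let v := ofConeStalkHom j n hφ (kernel.ι (toStalk s)) hj
  let m : cone1 (stalkHom j) ⟶ cone1 a.ι :=
    mkHom (jDesc j (a.pair ψ (r ≫ f₀)) (a.pair 0 gK)) (jCone_hom_ext fun W y x => by
      rw [← Category.assoc, ← Category.assoc, jPair_d, jPair_jDesc, jPair_jDesc, comp_pair,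
        comp_pair, pair_add, pair_d, comp_pair, comp_pair, pair_add, pair_inj]
      constructor
      · simp only [a, comp_zero, add_zero, Preadditive.comp_neg, Preadditive.neg_comp,
          Category.assoc, Preadditive.add_comp]
        rw [reassoc_of% hψ₂, hψ₁]
        abel
      · simp [reassoc_of% w])
  have hms : m ≫ a.s = v ≫ s := toStalk_ext (jCone_hom_ext fun W y x => by
    rw [toStalk_comp, toStalk_comp, ← Category.assoc, ← Category.assoc, jPair_ofConeStalkHom]
    simp only [m, mkHom_f, jPair_jDesc, comp_pair, pair_add, pair_s]
    simp [hns, a, hψ₂])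
  have hmg : m ≫ a.g = v ≫ g := toStalk_ext (jCone_hom_ext fun W y x => by
    rw [toStalk_comp, toStalk_comp, ← Category.assoc, ← Category.assoc, jPair_ofConeStalkHom]
    simp only [m, mkHom_f, jPair_jDesc, comp_pair, pair_add, pair_g]
    simp [hf₀, gK])
  have hm : HomologicalComplex.quasiIso A oneShape m :=
    MorphismProperty.of_postcomp _ m a.s a.quasiIso_s (by
      rw [hms]
      exact MorphismProperty.comp_mem _ _ _ hv hs)
  refine ⟨a, ?_, ?_⟩
  · apply eq_toHom
    have := isIso_QD_map m hm
    rw [← cancel_epi (QD.map m), ← Category.assoc, ← Functor.map_comp, ← Functor.map_comp, hms,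
      hmg, Functor.map_comp, Category.assoc, h, Functor.map_comp]
  · obtain ⟨e₁⟩ := nonempty_iso_of_quasiIso _ (quasiIso_coneMap v g hv)
    obtain ⟨e₂⟩ := nonempty_iso_of_quasiIso _ (quasiIso_coneMap m a.g hm)
    exact ⟨e₁.symm ≪≫ eqToIso (by rw [hmg]) ≪≫ e₂⟩

end StalkExtension

end ExtensionData

section Calculus

namespace OnePeriodic

variable {A : Type u} [Category.{v} A] [Abelian A]

lemma exists_of_homotopy {K L : OnePeriodic A} {a b : K ⟶ L} (H : Homotopy a b) :
    ∃ h : K.X () ⟶ L.X (), a.f () = K.d () () ≫ h + h ≫ L.d () () + b.f () := by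
  refine ⟨H.hom () (), ?_⟩
  have := H.comm ()
  rwa [dNext_eq (c := oneShape) _ (i := ()) (i' := ()) trivial,
    prevD_eq (c := oneShape) _ (j := ()) (j' := ()) trivial] at this

lemma exists_of_homotopy_toStalk {K : OnePeriodic A} {Y : A} {a b : K ⟶ stalkC Y}
    (H : Homotopy a b) : ∃ h : K.X () ⟶ Y, toStalk a = K.d () () ≫ h + toStalk b := by
  obtain ⟨h, hh⟩ := exists_of_homotopy H
  have key : h ≫ (stalkC Y).d () () = 0 := comp_zero
  rw [key, add_zero] at hh
  exact ⟨h, hh⟩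

open ZeroObject in
lemma exists_quasiIso_comp_homotopy_zero {Z V Y : OnePeriodic A} (f : Z ⟶ V) (s : V ⟶ Y)
    (hs : HomologicalComplex.quasiIso A oneShape s) (H : Homotopy (f ≫ s) 0) :
    ∃ (W : OnePeriodic A) (t : W ⟶ Z) (_ : HomologicalComplex.quasiIso A oneShape t),
      Nonempty (Homotopy (t ≫ f) 0) := by
  obtain ⟨h, hh⟩ := exists_of_homotopy H
  replace hh : f.f () ≫ s.f () = Z.d () () ≫ h + h ≫ Y.d () () := hh.trans (add_zero _)
  let c : Z ⟶ negD (cone1 s) := mkHom (L := negD (cone1 s)) (cPair s (-h) (f.f ())) (by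
    have key : cPair s (-h) (f.f ()) ≫ (-(cone1 s).d () ()) =
        Z.d () () ≫ cPair s (-h) (f.f ()) := by
      rw [Preadditive.comp_neg, cPair_d, neg_eq_iff_add_eq_zero, comp_cPair, cPair_add, hh,
        ← cPair_zero, cPair_inj]
      constructor
      · simp
      · simp
    exact key)
  let q : negD (cone1 s) ⟶ V := negDDesc (cDesc s 0 (𝟙 _)) (cone_hom_ext fun W y x => by
    rw [Preadditive.comp_neg, ← Category.assoc, ← Category.assoc, cPair_d, cPair_cDesc,
      cPair_cDesc]
    simp)
  have hcq : f = c ≫ q := hom_ext (by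
    have key : cPair s (-h) (f.f ()) ≫ cDesc s 0 (𝟙 _) = f.f () := by simp [cPair_cDesc]
    exact key.symm)
  let e : stalkC (0 : A) ⟶ negD (cone1 s) := stalkLift 0 zero_comp
  have he : HomologicalComplex.quasiIso A oneShape e := by
    rw [quasiIso_iff_up_to_refinements] at hs ⊢
    obtain ⟨h₁, h₂⟩ := hs
    refine ⟨fun W x _ _ _ => ⟨W, 𝟙 W, inferInstance, 0, (isZero_zero A).eq_of_tgt _ _⟩,
      fun W z hz => ?_⟩
    obtain ⟨y, v, rfl⟩ := exists_eq_cPair (g := s) z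
    replace hz : cPair s y v ≫ (cone1 s).d () () = 0 := by
      rw [← neg_eq_zero, ← Preadditive.comp_neg]
      exact hz
    rw [cPair_d, ← cPair_zero, cPair_inj, neg_eq_zero] at hz
    obtain ⟨hz₁, hz₂⟩ := hz
    obtain ⟨W₁, π₁, _, v', hv'⟩ := h₁ v hz₂ (-y) (by
      rw [Preadditive.neg_comp, eq_neg_iff_add_eq_zero, add_comm, hz₁])
    obtain ⟨W₂, π₂, _, v'', hv'', y', hy'⟩ := h₂ (π₁ ≫ y + v' ≫ s.f ()) (by
      rw [Preadditive.add_comp, Category.assoc, Category.assoc, HomologicalComplex.Hom.comm,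
        ← Category.assoc v', ← hv', Category.assoc, ← Preadditive.comp_add, hz₁, comp_zero])
    refine ⟨W₂, π₂ ≫ π₁, inferInstance, 0, zero_comp,
      cPair s (-y') (π₂ ≫ v' - v''), ?_⟩
    have key : (π₂ ≫ π₁) ≫ cPair s y v =
        cPair s (-y') (π₂ ≫ v' - v'') ≫ (-(cone1 s).d () ()) := by
      rw [Preadditive.comp_neg, cPair_d, eq_neg_iff_add_eq_zero, comp_cPair, cPair_add,
        ← cPair_zero, cPair_inj]
      rw [Preadditive.comp_add, ← sub_eq_iff_eq_add'] at hy'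
      constructor
      · simp only [Category.assoc, Preadditive.neg_comp, ← hy', Preadditive.sub_comp]
        abel
      · simp [hv', hv'']
    exact (key.trans (zero_add _).symm).trans (congrArg (· + _) zero_comp.symm)
  refine ⟨_, orePr₁ e c, quasiIso_orePr₁ e c he, ⟨?_⟩⟩
  have he₀ : e = 0 := hom_ext rfl
  rw [hcq, ← Category.assoc]
  refine ((oreHomotopy e c).compRight q).trans (Homotopy.ofEq ?_)
  rw [he₀, comp_zero, zero_comp]

instance : (HomotopyCategory.quasiIso A oneShape).HasRightCalculusOfFractions where
  exists_rightFraction X Y φ := by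
    obtain ⟨f, s, hs⟩ := φ
    rename_i T
    obtain ⟨X, rfl⟩ := HomotopyCategory.quotient_obj_surjective X
    obtain ⟨Y, rfl⟩ := HomotopyCategory.quotient_obj_surjective Y
    obtain ⟨T, rfl⟩ := HomotopyCategory.quotient_obj_surjective T
    obtain ⟨f, rfl⟩ := (HomotopyCategory.quotient A oneShape).map_surjective f
    obtain ⟨s, rfl⟩ := (HomotopyCategory.quotient A oneShape).map_surjective s
    rw [HomotopyCategory.quotient_map_mem_quasiIso_iff] at hs
    refine ⟨.mk ((HomotopyCategory.quotient A oneShape).map (orePr₁ s f))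
      ((HomotopyCategory.quotient_map_mem_quasiIso_iff _).2 (quasiIso_orePr₁ s f hs))
      ((HomotopyCategory.quotient A oneShape).map (orePr₂ s f)), ?_⟩
    dsimp
    rw [← Functor.map_comp, ← Functor.map_comp]
    exact HomotopyCategory.eq_of_homotopy _ _ (oreHomotopy s f)
  ext X Y T f₁ f₂ s hs h := by
    obtain ⟨X, rfl⟩ := HomotopyCategory.quotient_obj_surjective X
    obtain ⟨Y, rfl⟩ := HomotopyCategory.quotient_obj_surjective Y
    obtain ⟨T, rfl⟩ := HomotopyCategory.quotient_obj_surjective T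
    obtain ⟨f₁, rfl⟩ := (HomotopyCategory.quotient A oneShape).map_surjective f₁
    obtain ⟨f₂, rfl⟩ := (HomotopyCategory.quotient A oneShape).map_surjective f₂
    obtain ⟨s, rfl⟩ := (HomotopyCategory.quotient A oneShape).map_surjective s
    rw [HomotopyCategory.quotient_map_mem_quasiIso_iff] at hs
    rw [← sub_eq_zero, ← Preadditive.sub_comp, ← Functor.map_sub, ← Functor.map_comp,
      HomotopyCategory.quotient_map_eq_zero_iff] at h
    obtain ⟨W, t, ht, ht'⟩ := exists_quasiIso_comp_homotopy_zero _ _ hs h.some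
    refine ⟨_, (HomotopyCategory.quotient A oneShape).map t,
      (HomotopyCategory.quotient_map_mem_quasiIso_iff _).2 ht, ?_⟩
    rw [← sub_eq_zero, ← Preadditive.comp_sub, ← Functor.map_sub, ← Functor.map_comp,
      HomotopyCategory.quotient_map_eq_zero_iff]
    exact ht'

instance : (HomotopyCategory.quotient A oneShape).IsLocalization
    (HomologicalComplex.homotopyEquivalences A oneShape) :=
  ComplexShape.quotient_isLocalization (c := oneShape) (fun _ => ⟨(), trivial⟩) A

variable [MorphismProperty.HasLocalization.{w'} (HomologicalComplex.quasiIso A oneShape)]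

lemma exists_homotopy_of_QD_map_eq {K L : OnePeriodic A} {f g : K ⟶ L}
    (h : QD.map f = QD.map g) :
    ∃ (W : OnePeriodic A) (t : W ⟶ K) (_ : HomologicalComplex.quasiIso A oneShape t),
      Nonempty (Homotopy (t ≫ f) (t ≫ g)) := by
  have h' : HomologicalComplexUpToQuasiIso.Qh.map ((HomotopyCategory.quotient A oneShape).map f) =
      HomologicalComplexUpToQuasiIso.Qh.map ((HomotopyCategory.quotient A oneShape).map g) :=
    h
  rw [MorphismProperty.map_eq_iff_precomp _ (HomotopyCategory.quasiIso A oneShape)] at h'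
  obtain ⟨W, t, ht, hW⟩ := h'
  obtain ⟨W, rfl⟩ := HomotopyCategory.quotient_obj_surjective W
  obtain ⟨t, rfl⟩ := (HomotopyCategory.quotient A oneShape).map_surjective t
  rw [← Functor.map_comp, ← Functor.map_comp] at hW
  exact ⟨W, t, (HomotopyCategory.quotient_map_mem_quasiIso_iff _).1 ht,
    ⟨HomotopyCategory.homotopyOfEq _ _ hW⟩⟩

end OnePeriodic

end Calculus

section Injectivity

open OnePeriodic Abelian

variable {A : Type u} [Category.{v} A] [Abelian A] [HasExt.{w} A]

namespace StalkExtension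

variable {X Y : A} {a b : StalkExtension X Y}

lemma exists_hom_of_extClass_eq (h : a.shortExact.extClass = b.shortExact.extClass) :
    ∃ θ : a.E ⟶ b.E, a.i ≫ θ = b.i ∧ θ ≫ b.p = a.p := by
  obtain ⟨θ, h₁, h₂⟩ := a.shortExact.exists_hom b.shortExact (𝟙 _) (𝟙 _)
    (by rw [Ext.comp_mk₀_id, Ext.mk₀_id_comp, h])
  exact ⟨θ, h₁.trans (Category.id_comp _), h₂.trans (Category.comp_id _)⟩

lemma extClass_eq_of_hom (θ : a.E ⟶ b.E) (h₁ : a.i ≫ θ = b.i) (h₂ : θ ≫ b.p = a.p) :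
    a.shortExact.extClass = b.shortExact.extClass := by
  have := ShortComplex.ShortExact.extClass_naturality a.shortExact b.shortExact
    ⟨𝟙 _, θ, 𝟙 _, (Category.id_comp _).trans h₁.symm, h₂.trans (Category.comp_id _).symm⟩
  dsimp at this
  rwa [Ext.comp_mk₀_id, Ext.mk₀_id_comp] at this

lemma extClass_eq_of_epi {P : A} (q : P ⟶ X) [Epi q] (α : P ⟶ a.E) (α' : P ⟶ b.E)
    (β : kernel q ⟶ Y) (hα : α ≫ a.p = q) (hα' : α' ≫ b.p = q)
    (h : kernel.ι q ≫ α = β ≫ a.i) (h' : kernel.ι q ≫ α' = β ≫ b.i) :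
    a.shortExact.extClass = b.shortExact.extClass := by
  have hP : (ShortComplex.mk (kernel.ι q) q (kernel.condition q)).ShortExact :=
    { exact := ShortComplex.exact_kernel q }
  have h₁ := ShortComplex.ShortExact.extClass_naturality hP a.shortExact
    ⟨β, α, 𝟙 _, h.symm, hα.trans (Category.comp_id _).symm⟩
  have h₂ := ShortComplex.ShortExact.extClass_naturality hP b.shortExact
    ⟨β, α', 𝟙 _, h'.symm, hα'.trans (Category.comp_id _).symm⟩
  dsimp at h₁ h₂
  rw [Ext.mk₀_id_comp] at h₁ h₂
  rw [← h₁, h₂]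

lemma eq_of_homotopy {W : OnePeriodic A} (u : W ⟶ cone1 a.ι) (v : W ⟶ cone1 b.ι)
    (hu : HomologicalComplex.quasiIso A oneShape u) (h : W.X () ⟶ X)
    (hh : toStalk (u ≫ a.s) = W.d () () ≫ h + toStalk (v ≫ b.s)) (k : W.X () ⟶ Y)
    (hk : toStalk (u ≫ a.g) = W.d () () ≫ k + toStalk (v ≫ b.g)) :
    a.f = b.f ∧ a.shortExact.extClass = b.shortExact.extClass := by
  have hus := (quasiIso_toStalk_iff _).1 (MorphismProperty.comp_mem _ _ _ hu a.quasiIso_s)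
  obtain ⟨h₁, h₂⟩ := hus
  have hu' := u.comm () ()
  have hv' := v.comm () ()
  simp only [toStalk_comp] at hh hk h₁ h₂
  obtain ⟨e, y, he⟩ := exists_eq_pair (u.f ())
  obtain ⟨e', y', he'⟩ := exists_eq_pair (v.f ())
  rw [he, pair_d, comp_pair, pair_inj] at hu'
  rw [he', pair_d, comp_pair, pair_inj] at hv'
  obtain ⟨hu', -⟩ := hu'
  obtain ⟨hv', -⟩ := hv'
  simp only [he, he', pair_s, pair_g] at hh hk h₁ h₂
  have hai : Mono a.i := a.shortExact.mono_f
  have hbi : Mono b.i := b.shortExact.mono_f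
  let ζ := kernel.ι (W.d () ())
  have hζ : ζ ≫ W.d () () = 0 := kernel.condition _
  let q := ζ ≫ e ≫ a.p
  have hq : Epi q := by
    rw [epi_iff_surjective_up_to_refinements]
    intro V x
    obtain ⟨V', π, hπ, z, hz, hz'⟩ := h₂ x
    exact ⟨V', π, hπ, kernel.lift _ z hz, by simpa [q, ζ] using hz'⟩
  have hq' : q = ζ ≫ e' ≫ b.p := by simp [q, hh, reassoc_of% hζ]
  have hy : ζ ≫ y = ζ ≫ y' := by simp [hk, reassoc_of% hζ]
  have hqf : q ≫ a.f = - (ζ ≫ y) := by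
    rw [← cancel_mono a.i, eq_comm, ← sub_eq_zero]
    have := ζ ≫= hu'
    rw [reassoc_of% hζ, zero_comp] at this
    rw [← neg_eq_zero, ← this]
    simp [q]
  have hqf' : q ≫ b.f = - (ζ ≫ y) := by
    rw [← cancel_mono b.i, eq_comm, ← sub_eq_zero]
    have := ζ ≫= hv'
    rw [reassoc_of% hζ, zero_comp] at this
    rw [← neg_eq_zero, ← this, hy, hq']
    simp
  have hf : a.f = b.f := by rw [← cancel_epi q, hqf, hqf']
  refine ⟨hf, ?_⟩
  let β : kernel q ⟶ Y := a.shortExact.exact.lift (kernel.ι q ≫ ζ ≫ e) (by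
    simp [q])
  have hβ : β ≫ a.i = kernel.ι q ≫ ζ ≫ e := a.shortExact.exact.lift_f _ _
  refine extClass_eq_of_epi q (ζ ≫ e) (ζ ≫ e' + ζ ≫ (h ≫ a.f + k) ≫ b.i) β
    (Category.assoc _ _ _) (by simp [b.w, hq']) hβ.symm ?_
  obtain ⟨V, π, _, z, hz⟩ := h₁ (kernel.ι q ≫ ζ) (by rw [Category.assoc, hζ, comp_zero])
    (by simp [q])
  have hπβ : π ≫ β = z ≫ (e ≫ a.p ≫ a.f + y) := by
    rw [← cancel_mono a.i, Category.assoc, hβ, reassoc_of% hz, ← hu']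
    simp
  rw [← cancel_epi π, reassoc_of% hπβ, Preadditive.comp_add, Preadditive.comp_add,
    reassoc_of% hz, reassoc_of% hz, ← hv', ← hf, hk]
  simp only [Preadditive.comp_add, Preadditive.add_comp, Category.assoc, reassoc_of% hh]
  abel

section

variable [MorphismProperty.HasLocalization.{w'} (HomologicalComplex.quasiIso A oneShape)]

lemma eq_of_toHom_eq (h : a.toHom = b.toHom) :
    a.f = b.f ∧ a.shortExact.extClass = b.shortExact.extClass := by
  obtain ⟨W, t, ht, ⟨H⟩⟩ := exists_homotopy_of_QD_map_eq (f := orePr₁ b.s a.s ≫ a.g)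
    (g := orePr₂ b.s a.s ≫ b.g) (by
      rw [Functor.map_comp, Functor.map_comp, ← map_s_toHom, ← map_s_toHom, h,
        ← Functor.map_comp_assoc, ← Functor.map_comp_assoc,
        HomologicalComplexUpToQuasiIso.Q_map_eq_of_homotopy (oreHomotopy b.s a.s)])
  obtain ⟨h₁, hh₁⟩ := exists_of_homotopy_toStalk ((oreHomotopy b.s a.s).compLeft t)
  obtain ⟨h₂, hh₂⟩ := exists_of_homotopy_toStalk H
  rw [← Category.assoc, ← Category.assoc] at hh₁ hh₂
  exact eq_of_homotopy _ _
    (MorphismProperty.comp_mem _ _ _ ht (quasiIso_orePr₁ b.s a.s b.quasiIso_s)) h₁ hh₁ h₂ hh₂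

lemma toHom_eq (hf : a.f = b.f) (h : a.shortExact.extClass = b.shortExact.extClass) :
    a.toHom = b.toHom := by
  obtain ⟨θ, h₁, h₂⟩ := exists_hom_of_extClass_eq h
  apply eq_toHom
  have hs : coneHom θ h₁ h₂ hf ≫ b.s = a.s := toStalk_ext (cone_ι_hom_ext fun W y x => by
    rw [toStalk_comp, ← Category.assoc, coneHom, mkHom_f, pair_pairDesc, comp_pair, comp_pair,
      pair_add, pair_s, pair_s]
    simp [h₂])
  have hg : coneHom θ h₁ h₂ hf ≫ b.g = a.g := toStalk_ext (cone_ι_hom_ext fun W y x => by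
    rw [toStalk_comp, ← Category.assoc, coneHom, mkHom_f, pair_pairDesc, comp_pair, comp_pair,
      pair_add, pair_g, pair_g]
    simp)
  rw [← hs, ← hg, Functor.map_comp, Functor.map_comp, Category.assoc, map_s_toHom]

end

end StalkExtension

end Injectivity

section ExtensionClasses

open OnePeriodic Abelian

variable {A : Type u} [Category.{v} A] [Abelian A]

namespace StalkExtension

variable {X Y : A} (a : StalkExtension X Y)

lemma ι_π : a.ι ≫ a.π = 0 := hom_ext a.w

lemma shortExact_ι_π : (ShortComplex.mk a.ι a.π a.ι_π).ShortExact :=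
  HomologicalComplex.shortExact_of_degreewise_shortExact _ fun _ => a.shortExact

section

variable {a} {b : StalkExtension X Y} (θ : a.E ⟶ b.E) (h₁ : a.i ≫ θ = b.i) (h₂ : θ ≫ b.p = a.p)
  (hf : a.f = b.f)

/-- The morphism of complexes induced by a morphism of extensions. -/
def middleHom : a.middle ⟶ b.middle :=
  have key : θ ≫ b.p ≫ b.f ≫ b.i = (a.p ≫ a.f ≫ a.i) ≫ θ := by simp [h₁, reassoc_of% h₂, hf]
  mkHom (K := a.middle) (L := b.middle) θ key

/-- The morphism of short exact sequences of complexes induced by a morphism of extensions. -/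
def shortComplexHom :
    ShortComplex.mk a.ι a.π a.ι_π ⟶ ShortComplex.mk b.ι b.π b.ι_π :=
  have key₁ : b.ι = a.ι ≫ middleHom θ h₁ h₂ hf := hom_ext h₁.symm
  have key₂ : middleHom θ h₁ h₂ hf ≫ b.π = a.π := hom_ext h₂
  ⟨𝟙 _, middleHom θ h₁ h₂ hf, 𝟙 _, (Category.id_comp _).trans key₁,
    key₂.trans (Category.comp_id _).symm⟩

include h₁ h₂ hf in
lemma nonempty_middle_iso : Nonempty (a.middle ≅ b.middle) := by
  have : IsIso (shortComplexHom θ h₁ h₂ hf).τ₁ := inferInstanceAs (IsIso (𝟙 _))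
  have : IsIso (shortComplexHom θ h₁ h₂ hf).τ₃ := inferInstanceAs (IsIso (𝟙 _))
  have := ShortComplex.isIso₂_of_shortExact_of_isIso₁₃ (shortComplexHom θ h₁ h₂ hf)
    a.shortExact_ι_π b.shortExact_ι_π
  exact ⟨asIso (shortComplexHom θ h₁ h₂ hf).τ₂⟩

end

variable [HasExt.{w''} (OnePeriodic A)]

/-- The class of an extension of stalk complexes. -/
def cls : Ext (stalkC X) (stalkC Y) 1 := a.shortExact_ι_π.extClass

lemma eq_of_cls_eq [HasExt.{w} A] {a b : StalkExtension X Y} (h : a.cls = b.cls) :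
    a.f = b.f ∧ a.shortExact.extClass = b.shortExact.extClass := by
  obtain ⟨t, h₁, h₂⟩ := a.shortExact_ι_π.exists_hom b.shortExact_ι_π (𝟙 _) (𝟙 _)
    (by rw [Ext.comp_mk₀_id, Ext.mk₀_id_comp]; exact h)
  let θ : a.E ⟶ b.E := t.f ()
  have k₁ : a.i ≫ θ = b.i :=
    congrArg (fun t => ofStalk t) (h₁.trans (Category.id_comp _))
  have k₂ : θ ≫ b.p = a.p :=
    congrArg (fun t => toStalk t) (h₂.trans (Category.comp_id _))
  refine ⟨?_, extClass_eq_of_hom θ k₁ k₂⟩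
  have k₃ : θ ≫ b.p ≫ b.f ≫ b.i = (a.p ≫ a.f ≫ a.i) ≫ θ := t.comm () ()
  have : Epi a.p := a.shortExact.epi_g
  have : Mono b.i := b.shortExact.mono_f
  rw [reassoc_of% k₂, Category.assoc, Category.assoc, k₁] at k₃
  rw [← cancel_mono b.i, ← cancel_epi a.p, k₃]

lemma cls_eq [HasExt.{w} A] {a b : StalkExtension X Y} (hf : a.f = b.f)
    (h : a.shortExact.extClass = b.shortExact.extClass) :
    a.cls = b.cls := by
  obtain ⟨θ, h₁, h₂⟩ := exists_hom_of_extClass_eq h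
  have := ShortComplex.ShortExact.extClass_naturality a.shortExact_ι_π b.shortExact_ι_π
    (shortComplexHom θ h₁ h₂ hf)
  dsimp [shortComplexHom] at this
  rwa [Ext.comp_mk₀_id, Ext.mk₀_id_comp] at this

lemma extHasMiddle_iff (K : OnePeriodic A) (e : Ext (stalkC X) (stalkC Y) 1) :
    extHasMiddle (stalkC X) (stalkC Y) K e ↔
      ∃ a : StalkExtension X Y, a.cls = e ∧ Nonempty (a.middle ≅ K) := by
  constructor
  · rintro ⟨S, hS, i₁, i₃, ⟨e⟩, rfl⟩
    obtain ⟨i, hi⟩ : ∃ i : Y ⟶ S.X₂.X (), i = ofStalk (i₁.inv ≫ S.f) := ⟨_, rfl⟩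
    obtain ⟨p, hp⟩ : ∃ p : S.X₂.X () ⟶ X, p = toStalk (S.g ≫ i₃.inv) := ⟨_, rfl⟩
    have hid : i ≫ S.X₂.d () () = 0 := by rw [hi, ofStalk_d]
    have hdp : S.X₂.d () () ≫ p = 0 := by rw [hp, d_toStalk]
    have hw : (i₁.inv ≫ S.f) ≫ S.g ≫ i₃.inv = 0 := by simp
    have w : i ≫ p = 0 := by
      rw [hi, hp]
      exact congrArg (fun t => HomologicalComplex.Hom.f t ()) hw
    have hS' : (ShortComplex.mk (i₁.inv ≫ S.f) (S.g ≫ i₃.inv) hw).ShortExact :=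
      ShortComplex.shortExact_of_iso (ShortComplex.isoMk i₁ (Iso.refl _) i₃.symm) hS
    have hE : (ShortComplex.mk i p w).ShortExact := by
      subst hi hp
      exact hS'.map_of_exact (HomologicalComplex.eval A oneShape ())
    have := hE.mono_f
    have := hE.epi_g
    obtain ⟨f, hf⟩ : ∃ f : X ⟶ Y, S.X₂.d () () = p ≫ f ≫ i := by
      let d' : X ⟶ S.X₂.X () := hE.exact.desc (S.X₂.d () ()) hid
      have hd' : p ≫ d' = S.X₂.d () () := hE.exact.g_desc _ _
      let f : X ⟶ Y := hE.exact.lift d' (by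
        dsimp
        rw [← cancel_epi p, reassoc_of% hd', hdp, comp_zero])
      have hf : f ≫ i = d' := hE.exact.lift_f _ _
      exact ⟨f, by rw [hf, hd']⟩
    let a : StalkExtension X Y := ⟨S.X₂.X (), i, p, w, hE, f⟩
    let θ : S.X₂ ≅ a.middle :=
      HomologicalComplex.Hom.isoOfComponents (fun _ => Iso.refl (S.X₂.X ())) fun _ _ _ =>
        ((Category.id_comp _).trans hf.symm).trans (Category.comp_id _).symm
    have k₁ : (i₁.inv ≫ S.f) ≫ θ.hom = a.ι := hom_ext ((Category.comp_id _).trans hi.symm)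
    have k₂ : θ.hom ≫ a.π = S.g ≫ i₃.inv := hom_ext ((Category.id_comp _).trans hp)
    refine ⟨a, ?_, ⟨θ.symm ≪≫ e⟩⟩
    have := ShortComplex.ShortExact.extClass_naturality hS a.shortExact_ι_π
      ⟨i₁.hom, θ.hom, i₃.inv, by simp [← k₁], k₂⟩
    dsimp at this
    rw [this, Ext.mk₀_comp_mk₀_assoc, Iso.hom_inv_id, Ext.mk₀_id_comp]
    rfl
  · rintro ⟨a, rfl, ⟨e⟩⟩
    exact ⟨_, a.shortExact_ι_π, Iso.refl _, Iso.refl _, ⟨e⟩, by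
      dsimp
      rw [Ext.comp_mk₀_id, Ext.mk₀_id_comp]
      rfl⟩

end StalkExtension

end ExtensionClasses

section Counting

lemma card_exists_and_eq {S : Type*} {I : Type*} {β : Type*} (r : S → I) (c : S → β)
    (h : ∀ a b, r a = r b ↔ c a = c b) (P : S → Prop) :
    Nat.card {e : β // ∃ a, c a = e ∧ P a} = {i : I | ∃ a, r a = i ∧ P a}.ncard := by
  refine Nat.card_congr (Equiv.ofBijective
    (fun e => ⟨r e.2.choose, _, rfl, e.2.choose_spec.2⟩) ⟨?_, ?_⟩)
  · rintro ⟨e, he⟩ ⟨e', he'⟩ hee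
    rw [Subtype.mk.injEq, h, he.choose_spec.1, he'.choose_spec.1] at hee
    exact Subtype.ext hee
  · rintro ⟨_, a, rfl, ha⟩
    have he : ∃ a', c a' = c a ∧ P a' := ⟨a, rfl, ha⟩
    exact ⟨⟨c a, he⟩, Subtype.ext ((h _ _).2 he.choose_spec.1)⟩

lemma ncard_eq_finsum_ncard_fiber {S : Type*} {I : Type*} [Finite I] {γ : Type*} (r : S → I)
    (m : S → γ) (h : ∀ a b, r a = r b → m a = m b) (P : S → Prop) :
    {i : I | ∃ a, r a = i ∧ P a}.ncard =
      ∑ᶠ x : γ, {i : I | ∃ a, r a = i ∧ P a ∧ m a = x}.ncard := by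
  classical
  have := Fintype.ofFinite I
  by_cases hγ : Nonempty S
  · let κ : I → γ := fun i => m (Function.invFun r i)
    have hκ (a : S) : κ (r a) = m a := h _ _ (Function.invFun_eq ⟨a, rfl⟩)
    have h₁ (x : γ) : {i : I | ∃ a, r a = i ∧ P a ∧ m a = x}.ncard =
        (Finset.univ.filter fun i => (∃ a, r a = i ∧ P a) ∧ κ i = x).card := by
      rw [← Set.ncard_coe_finset]
      congr 1
      ext i
      simp only [Set.mem_ofPred_eq, Finset.coe_filter, Finset.mem_univ, true_and]
      constructor
      · rintro ⟨a, rfl, ha, rfl⟩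
        exact ⟨⟨a, rfl, ha⟩, hκ a⟩
      · rintro ⟨⟨a, rfl, ha⟩, rfl⟩
        exact ⟨a, rfl, ha, (hκ a).symm⟩
    have h₂ : {i : I | ∃ a, r a = i ∧ P a}.ncard =
        (Finset.univ.filter fun i => ∃ a, r a = i ∧ P a).card := by
      rw [← Set.ncard_coe_finset]
      simp
    simp only [h₁]
    rw [h₂, finsum_eq_sum_of_support_subset (s := Finset.univ.image κ),
      Finset.card_eq_sum_card_fiberwise (f := κ) (t := Finset.univ.image κ)]
    · simp only [Finset.filter_filter]
    · intro i _
      simp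
    · intro x hx
      rw [Function.mem_support, Finset.card_ne_zero] at hx
      obtain ⟨i, hi⟩ := hx
      simp only [Finset.mem_filter] at hi
      simp [← hi.2.2]
  · rw [not_nonempty_iff] at hγ
    simp

open OnePeriodic Abelian

variable {A : Type u} [Category.{v} A] [Abelian A] [HasExt.{w} A]
  [MorphismProperty.HasLocalization.{w'} (HomologicalComplex.quasiIso A oneShape)]

lemma isConeOf_iff (hHered : ∀ X Y : A, Subsingleton (Abelian.Ext X Y 2)) {X Y : A}
    (φ : QD.obj (stalkC X) ⟶ QD.obj (stalkC Y)) (M : A) :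
    IsConeOf φ M ↔
      ∃ a : StalkExtension X Y, a.toHom = φ ∧ Nonempty (cohomology a.middle ≅ M) := by
  constructor
  · rintro ⟨Z, s, g, hs, h, ⟨e⟩⟩
    obtain ⟨a, ha, ⟨e'⟩⟩ := StalkExtension.exists_of_fraction hHered φ s g hs h
    exact ⟨a, ha, (StalkExtension.nonempty_cone_g_iso_iff hHered M).1 ⟨e'.symm ≪≫ e⟩⟩
  · rintro ⟨a, rfl, h⟩
    exact ⟨_, a.s, a.g, a.quasiIso_s, StalkExtension.map_s_toHom,
      (StalkExtension.nonempty_cone_g_iso_iff hHered M).2 h⟩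

end Counting

open Classical in
/-- **Statement 6** (Lemma 3.2): for objects `A, B, M` of `A`,
`|(A,B)_M| = Σ_{[X•] : H(X•) ≅ M} |Ext¹_{C₁(A)}(A, B)_{X•}|`. -/
theorem cone_count_eq_sum_of_extension_counts
    (k : Type) [Field k] [Fintype k]
    {A : Type u} [Category.{v} A] [Abelian A] [Linear k A] [EssentiallySmall.{v} A]
    [HasExt.{w} A] [HasExt.{w''} (OnePeriodic A)] [∀ X Y : A, Finite (X ⟶ Y)]
    (hExtFin : ∀ X Y : A, Finite (Abelian.Ext X Y 1))
    (hHered : ∀ X Y : A, Subsingleton (Abelian.Ext X Y 2))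
    [MorphismProperty.HasLocalization.{w'} (HomologicalComplex.quasiIso A oneShape)]
    (X Y M : A) :
    coneCount X Y M =
      ∑ᶠ x : IsoCls (OnePeriodic A),
        if Nonempty (cohomology x.out ≅ M) then extMiddleCard (stalkC X) (stalkC Y) x.out
        else 0 := by
  let r : StalkExtension X Y → (X ⟶ Y) × Abelian.Ext X Y 1 := fun a =>
    (a.f, a.shortExact.extClass)
  have hr (a b : StalkExtension X Y) : r a = r b ↔
      a.f = b.f ∧ a.shortExact.extClass = b.shortExact.extClass := Prod.ext_iff
  have h₁ (a b : StalkExtension X Y) : r a = r b ↔ a.toHom = b.toHom := by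
    rw [hr]
    exact ⟨fun h => StalkExtension.toHom_eq h.1 h.2, StalkExtension.eq_of_toHom_eq⟩
  have h₂ (a b : StalkExtension X Y) : r a = r b ↔ a.cls = b.cls := by
    rw [hr]
    exact ⟨fun h => StalkExtension.cls_eq h.1 h.2, StalkExtension.eq_of_cls_eq⟩
  have h₃ (a b : StalkExtension X Y) (h : r a = r b) : mkIso a.middle = mkIso b.middle := by
    rw [hr] at h
    obtain ⟨θ, k₁, k₂⟩ := StalkExtension.exists_hom_of_extClass_eq h.2
    exact Quotient.sound (StalkExtension.nonempty_middle_iso θ k₁ k₂ h.1)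
  have : Finite (Abelian.Ext X Y 1) := hExtFin X Y
  simp only [coneCount, isConeOf_iff hHered]
  rw [card_exists_and_eq r _ h₁, ncard_eq_finsum_ncard_fiber r _ h₃]
  refine finsum_congr fun x => ?_
  have hx (a : StalkExtension X Y) : mkIso a.middle = x ↔ Nonempty (a.middle ≅ x.out) :=
    Quotient.mk_eq_iff_out
  have hH {K L : OnePeriodic A} (e : K ≅ L) : cohomology K ≅ cohomology L :=
    (HomologicalComplex.homologyFunctor A oneShape ()).mapIso e
  split_ifs with h
  · simp only [extMiddleCard, StalkExtension.extHasMiddle_iff]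
    rw [card_exists_and_eq r _ h₂]
    congr 1
    ext i
    refine exists_congr fun a => and_congr_right fun _ => ?_
    rw [hx]
    exact ⟨fun h => h.2, fun ⟨e⟩ => ⟨⟨hH e ≪≫ h.some⟩, ⟨e⟩⟩⟩
  · rw [Set.ncard_eq_zero, Set.eq_empty_iff_forall_notMem]
    rintro i ⟨a, -, ⟨e⟩, ha⟩
    rw [hx] at ha
    exact h ⟨(hH ha.some).symm ≪≫ e⟩

end
end

section
/- Let A be an essentially small hereditary abelian category, linear over a finite field F_q, with finite-dimensional Hom and Ext spaces. For any two 1-periodic complexes X•, Y• over A, X• and Y• are isomorphic in the 1-periodic derived category D₁(A) if and only if their cohomologies H(X•) and H(Y•) are isomorphic in A. In particular, every 1-periodic complex X• is isomorphic in D₁(A) to the stalk complex on H(X•). -/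
/-!
Formalization of statements from "ıquantum groups of split type via derived Hall algebras"
(Chen–Lu–Ruan).  We set up 1-periodic complexes, the 1-periodic derived category,
derived Hall algebras and ıHall algebras.
-/

open CategoryTheory Limits

noncomputable section

universe w w' w'' v u

open CategoryTheory.Abelian in
/-- Every class in `Ext¹` is annihilated by pulling back along some epimorphism. -/
lemma CategoryTheory.Abelian.Ext.exists_epi_mk₀_comp_eq_zero
    {A : Type u} [Category.{v} A] [Abelian A] [HasExt.{w} A] {H X : A} (x : Ext H X 1) :
    ∃ (P : A) (π : P ⟶ H) (_ : Epi π), (Ext.mk₀ π).comp x (zero_add 1) = 0 := by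
  let := HasDerivedCategory.standard A
  let e := ((DerivedCategory.singleFunctors A).shiftIso 1 (-1) 0 (by simp)).app X
  let SH : CochainComplex A ℤ := (HomologicalComplex.single A (.up ℤ) 0).obj H
  let SX : CochainComplex A ℤ := (HomologicalComplex.single A (.up ℤ) (-1)).obj X
  let f : DerivedCategory.Q.obj SH ⟶ DerivedCategory.Q.obj SX := x.hom ≫ e.hom
  obtain ⟨K, _, s, hs, g, hg⟩ := DerivedCategory.right_fac_of_isStrictlyLE f 0
  have hd : K.d 0 1 = 0 := (K.isZero_of_isStrictlyLE 0 1).eq_of_tgt _ _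
  let t : (HomologicalComplex.single A (.up ℤ) 0).obj (K.X 0) ⟶ K :=
    HomologicalComplex.mkHomFromSingle (𝟙 _) (by
      rintro j hj
      obtain rfl : 1 = j := by simpa using hj
      simp [hd])
  let π : K.X 0 ⟶ H := s.f 0 ≫ (HomologicalComplex.singleObjXSelf (.up ℤ) 0 H).hom
  have ht : t ≫ s = (HomologicalComplex.single A (.up ℤ) 0).map π := by
    apply HomologicalComplex.from_single_hom_ext
    simp [t, π, HomologicalComplex.single_map_f_self]
  have ht' : t ≫ g = 0 := by
    apply HomologicalComplex.from_single_hom_ext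
    apply IsZero.eq_of_tgt
    exact HomologicalComplex.isZero_single_obj_X _ _ _ _ (by simp)
  have : Epi (s.f 0) := by
    rw [epi_iff_surjective_up_to_refinements]
    intro T y
    have hq : QuasiIso s := (DerivedCategory.isIso_Q_map_iff_quasiIso _ s).1 hs
    have := (HomologicalComplex.epi_homologyMap_iff_up_to_refinements s (-1) 0 1
      (by simp) (by simp)).1 inferInstance y
      (by simp [SH])
    obtain ⟨T', p, hp, z, hz, y₁, hy⟩ := this
    refine ⟨T', p, hp, z, ?_⟩
    simpa [SH] using hy
  refine ⟨K.X 0, π, inferInstance, ?_⟩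
  ext
  rw [Ext.comp_hom, Ext.mk₀_hom, ShiftedHom.mk₀_comp, Ext.zero_hom, ← cancel_mono e.hom,
    Limits.zero_comp, Category.assoc]
  change DerivedCategory.Q.map ((HomologicalComplex.single A (.up ℤ) 0).map π) ≫ f = 0
  rw [← ht, hg]
  rw [Functor.map_comp, Category.assoc, IsIso.hom_inv_id_assoc, ← Functor.map_comp, ht',
    Functor.map_zero]

open CategoryTheory.Abelian in
/-- If `Ext²(S₁.X₃, S₂.X₁)` vanishes, the extension `S₁` of `S₁.X₃` by `S₁.X₁ = S₂.X₃` lifts to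
an extension of `S₁.X₃` by `S₂.X₂`. -/
lemma CategoryTheory.ShortComplex.ShortExact.exists_lift_extension
    {A : Type u} [Category.{v} A] [Abelian A] [HasExt.{w} A] {Z H K X B : A}
    {j : B ⟶ Z} {q : Z ⟶ H} {i : K ⟶ X} {p : X ⟶ B} {hjq : j ≫ q = 0} {hip : i ≫ p = 0}
    (h₁ : (ShortComplex.mk j q hjq).ShortExact) (h₂ : (ShortComplex.mk i p hip).ShortExact)
    [Subsingleton (Ext H K 2)] :
    ∃ (E : A) (a : X ⟶ E) (r : E ⟶ Z) (w : a ≫ r ≫ q = 0),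
      (ShortComplex.mk a (r ≫ q) w).ShortExact ∧ a ≫ r = p ≫ j := by
  obtain ⟨x, hx⟩ := Ext.covariant_sequence_exact₃ H h₂ h₁.extClass (n₁ := 2) rfl
    (Subsingleton.elim _ _)
  obtain ⟨P, π, _, hπ⟩ := Ext.exists_epi_mk₀_comp_eq_zero x
  have h₃ : (ShortComplex.mk (kernel.ι π) π (kernel.condition π)).ShortExact :=
    { exact := ShortComplex.exact_of_f_is_kernel _ (kernelIsKernel π) }
  obtain ⟨y', hy⟩ := Ext.contravariant_sequence_exact₃ h₃ X x hπ (n₀ := 0) rfl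
  obtain ⟨y, rfl⟩ := (Ext.mk₀_bijective _ _).2 y'
  obtain ⟨g', hg⟩ := Ext.covariant_sequence_exact₃ P h₁ (Ext.mk₀ π) (n₁ := 1) rfl (by
    rw [← hx]
    change (Ext.mk₀ π).comp (x.comp (Ext.mk₀ p) _) _ = 0
    rw [← Ext.comp_assoc_of_third_deg_zero, hπ, Ext.zero_comp])
  obtain ⟨g₀, rfl⟩ := (Ext.mk₀_bijective _ _).2 g'
  replace hg : g₀ ≫ q = π := (Ext.mk₀_bijective _ _).1 (by simpa using hg)
  have := h₁.mono_f
  dsimp at this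
  let b : kernel π ⟶ B := h₁.exact.lift (kernel.ι π ≫ g₀) (by simp [hg])
  have hb : b ≫ j = kernel.ι π ≫ g₀ := h₁.exact.lift_f _ _
  have hb' := ShortComplex.ShortExact.extClass_naturality h₃ h₁
    { τ₁ := b, τ₂ := g₀, τ₃ := 𝟙 H, comm₁₂ := hb, comm₂₃ := by simpa using hg }
  obtain ⟨h', hh⟩ := Ext.contravariant_sequence_exact₁ h₃ B (Ext.mk₀ (b - y ≫ p)) (n₁ := 1) rfl (by
    simp only [sub_eq_add_neg, Ext.mk₀_add, Ext.mk₀_neg, Ext.comp_add, Ext.comp_neg]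
    rw [← Ext.mk₀_comp_mk₀, ← Ext.comp_assoc_of_third_deg_zero, hy]
    simp only [Ext.mk₀_id_comp] at hb'
    exact add_neg_eq_zero.2 (hb'.trans hx.symm))
  obtain ⟨h, rfl⟩ := (Ext.mk₀_bijective _ _).2 h'
  replace hh : kernel.ι π ≫ h = b - y ≫ p := (Ext.mk₀_bijective _ _).1 (by simpa using hh)
  have hg₁ : (g₀ - h ≫ j) ≫ q = π := by simp [hjq, hg]
  have comm : kernel.ι π ≫ (g₀ - h ≫ j) = y ≫ p ≫ j := by
    rw [Preadditive.comp_sub, reassoc_of% hh, Preadditive.sub_comp, hb, Category.assoc]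
    abel
  let r : pushout (kernel.ι π) y ⟶ Z := pushout.desc (g₀ - h ≫ j) (p ≫ j) comm
  have hr₁ : pushout.inl (kernel.ι π) y ≫ r = g₀ - h ≫ j := pushout.inl_desc _ _ _
  have hr₂ : pushout.inr (kernel.ι π) y ≫ r = p ≫ j := pushout.inr_desc _ _ _
  have w : pushout.inr (kernel.ι π) y ≫ r ≫ q = 0 := by
    rw [reassoc_of% hr₂, hjq, comp_zero]
  have hr₃ : pushout.inl (kernel.ι π) y ≫ r ≫ q = π := by rw [reassoc_of% hr₁, hg₁]
  have : Epi (r ≫ q) := epi_of_epi_fac hr₃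
  refine ⟨_, pushout.inr _ _, r, w, { exact := ?_ }, hr₂⟩
  refine ShortComplex.exact_of_g_is_cokernel _ (CokernelCofork.IsColimit.ofπ' _ _ fun k hk ↦ ?_)
  have hk' : kernel.ι π ≫ pushout.inl (kernel.ι π) y ≫ k = 0 := by
    rw [pushout.condition_assoc, hk, comp_zero]
  refine ⟨h₃.exact.desc (pushout.inl _ _ ≫ k) hk', ?_⟩
  apply pushout.hom_ext
  · dsimp only
    rw [Category.assoc, reassoc_of% hr₃]
    exact h₃.exact.g_desc _ _
  · dsimp only at hk ⊢
    rw [Category.assoc, reassoc_of% w, hk, zero_comp]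

/-- The complex `X ⊕ E` whose differential is the off-diagonal map `a : X ⟶ E`. -/
def offDiagC {A : Type u} [Category.{v} A] [Abelian A] {X E : A} (a : X ⟶ E) : OnePeriodic A where
  X _ := X ⊞ E
  d _ _ := biprod.fst ≫ a ≫ biprod.inr
  shape _ _ h := absurd trivial h
  d_comp_d' := by intros; simp

/-- A criterion for a morphism of `1`-periodic complexes to be a quasi-isomorphism, in terms of
generalized elements. -/
lemma quasiIso_of_refinements {A : Type u} [Category.{v} A] [Abelian A] {K L : OnePeriodic A}
    (φ : K ⟶ L)
    (hmono : ∀ ⦃T : A⦄ (x : T ⟶ K.X ()) (_ : x ≫ K.d () () = 0) (y : T ⟶ L.X ())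
      (_ : x ≫ φ.f () = y ≫ L.d () ()),
      ∃ (T' : A) (π : T' ⟶ T) (_ : Epi π) (z : T' ⟶ K.X ()), π ≫ x = z ≫ K.d () ())
    (hepi : ∀ ⦃T : A⦄ (y : T ⟶ L.X ()) (_ : y ≫ L.d () () = 0),
      ∃ (T' : A) (π : T' ⟶ T) (_ : Epi π) (x : T' ⟶ K.X ()) (_ : x ≫ K.d () () = 0)
        (z : T' ⟶ L.X ()), π ≫ y = x ≫ φ.f () + z ≫ L.d () ()) :
    HomologicalComplex.quasiIso A oneShape φ := by
  rw [HomologicalComplex.mem_quasiIso_iff, quasiIso_iff]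
  intro ⟨⟩
  rw [quasiIsoAt_iff_isIso_homologyMap]
  have := (HomologicalComplex.mono_homologyMap_iff_up_to_refinements φ () () () rfl rfl).2 hmono
  have := (HomologicalComplex.epi_homologyMap_iff_up_to_refinements φ () () () rfl rfl).2 hepi
  exact isIso_of_mono_of_epi _

/-- Over a hereditary abelian category, a `1`-periodic complex and the stalk complex on its
cohomology are connected by a roof of quasi-isomorphisms. -/
lemma exists_quasiIso_roof_stalkC_cohomology {A : Type u} [Category.{v} A] [Abelian A]
    [HasExt.{w} A] (hHered : ∀ X Y : A, Subsingleton (Abelian.Ext X Y 2)) (M : OnePeriodic A) :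
    ∃ (W : OnePeriodic A) (f : W ⟶ M) (g : W ⟶ stalkC (cohomology M)),
      HomologicalComplex.quasiIso A oneShape f ∧ HomologicalComplex.quasiIso A oneShape g := by
  have hq : (ShortComplex.mk (M.toCycles () ()) (M.homologyπ ()) (by simp)).Exact :=
    ShortComplex.exact_of_g_is_cokernel _ (M.homologyIsCokernel () () rfl)
  let j := kernel.ι (M.homologyπ ())
  let p : M.X () ⟶ kernel (M.homologyπ ()) := kernel.lift _ (M.toCycles () ()) (by simp)
  have hpj : p ≫ j = M.toCycles () () := kernel.lift_ι _ _ _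
  have hpd : p ≫ j ≫ M.iCycles () = M.d () () := by simp [reassoc_of% hpj]
  have : Epi p := hq.epi_kernelLift
  have h₁ : (ShortComplex.mk j (M.homologyπ ()) (kernel.condition _)).ShortExact :=
    { exact := ShortComplex.exact_of_f_is_kernel _ (kernelIsKernel _) }
  have hip : M.iCycles () ≫ p = 0 := by
    rw [← cancel_mono (j ≫ M.iCycles ()), Category.assoc, hpd]
    simp
  have h₂ : (ShortComplex.mk (M.iCycles ()) p hip).ShortExact :=
    { exact := ShortComplex.exact_of_f_is_kernel _ (KernelFork.IsLimit.ofι' _ _ fun k hk ↦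
        ⟨M.liftCycles k () rfl (by rw [← hpd, reassoc_of% hk, zero_comp]), by simp⟩) }
  obtain ⟨E, a, r, w, hE, har⟩ := h₁.exists_lift_extension h₂
  have := hE.mono_f
  have := hE.epi_g
  dsimp at *
  have f_comm : biprod.desc (𝟙 (M.X ())) (r ≫ M.iCycles ()) ≫ M.d () () =
      (biprod.fst ≫ a ≫ biprod.inr) ≫ biprod.desc (𝟙 (M.X ())) (r ≫ M.iCycles ()) := by
    apply biprod.hom_ext' <;> simp [reassoc_of% har, hpd]
  let f : offDiagC a ⟶ M :=
    { f _ := biprod.desc (𝟙 _) (r ≫ M.iCycles ())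
      comm' _ _ _ := f_comm }
  have g_comm : (biprod.snd ≫ r ≫ M.homologyπ ()) ≫ (0 : M.homology () ⟶ M.homology ()) =
      (biprod.fst ≫ a ≫ biprod.inr : M.X () ⊞ E ⟶ M.X () ⊞ E) ≫
        biprod.snd ≫ r ≫ M.homologyπ () := by
    simp [w]
  let g : offDiagC a ⟶ stalkC (cohomology M) :=
    { f _ := (biprod.snd ≫ r ≫ M.homologyπ () : M.X () ⊞ E ⟶ _)
      comm' _ _ _ := g_comm }
  have hcyc {T : A} (x : T ⟶ M.X () ⊞ E)
      (hx : x ≫ biprod.fst ≫ a ≫ (biprod.inr : E ⟶ M.X () ⊞ E) = 0) :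
      x = (x ≫ biprod.snd) ≫ biprod.inr := by
    have : x ≫ biprod.fst = 0 := by
      rw [← cancel_mono a, ← cancel_mono (biprod.inr : E ⟶ M.X () ⊞ E)]
      simpa using hx
    apply biprod.hom_ext <;> simp [this]
  have hbound {T : A} (x : T ⟶ M.X () ⊞ E)
      (hx : x ≫ biprod.fst ≫ a ≫ (biprod.inr : E ⟶ M.X () ⊞ E) = 0)
      (hx' : (x ≫ biprod.snd) ≫ r ≫ M.homologyπ () = 0) :
      ∃ (T' : A) (π : T' ⟶ T) (_ : Epi π) (z : T' ⟶ M.X () ⊞ E),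
        π ≫ x = z ≫ biprod.fst ≫ a ≫ biprod.inr := by
    obtain ⟨l, hl⟩ : ∃ l, l ≫ a = x ≫ biprod.snd :=
      ⟨hE.exact.lift _ hx', hE.exact.lift_f _ hx'⟩
    refine ⟨T, 𝟙 T, inferInstance, l ≫ biprod.inl, ?_⟩
    rw [Category.id_comp]
    refine (hcyc x hx).trans ?_
    rw [← hl]
    simp
  have hinr {T : A} (e : T ⟶ E) :
      (e ≫ (biprod.inr : E ⟶ M.X () ⊞ E)) ≫ biprod.fst ≫ a ≫ (biprod.inr : E ⟶ M.X () ⊞ E) = 0 := by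
    simp
  have f_inj {T : A} (x : T ⟶ M.X () ⊞ E)
      (hx : x ≫ biprod.fst ≫ a ≫ (biprod.inr : E ⟶ M.X () ⊞ E) = 0) (y : T ⟶ M.X ())
      (hy : x ≫ biprod.desc (𝟙 _) (r ≫ M.iCycles ()) = y ≫ M.d () ()) :
      (x ≫ biprod.snd) ≫ r ≫ M.homologyπ () = 0 := by
    have : (x ≫ biprod.snd) ≫ r = y ≫ M.toCycles () () := by
      rw [← cancel_mono (M.iCycles ()), Category.assoc y, M.toCycles_i, ← hy]
      conv_rhs => rw [hcyc x hx]
      simp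
    rw [← Category.assoc, this]
    simp
  have g_inj {T : A} (x : T ⟶ M.X () ⊞ E) (y : T ⟶ M.homology ())
      (hy : x ≫ biprod.snd ≫ r ≫ M.homologyπ () = y ≫ (0 : M.homology () ⟶ M.homology ())) :
      (x ≫ biprod.snd) ≫ r ≫ M.homologyπ () = 0 := by
    simpa using hy
  have g_surj {T : A} (e : T ⟶ E) (y : T ⟶ M.homology ()) (he : y = e ≫ r ≫ M.homologyπ ()) :
      y = (e ≫ (biprod.inr : E ⟶ M.X () ⊞ E)) ≫ biprod.snd ≫ r ≫ M.homologyπ () +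
        (0 : T ⟶ M.homology ()) ≫ (0 : M.homology () ⟶ M.homology ()) := by
    simp [he]
  refine ⟨offDiagC a, f, g, quasiIso_of_refinements f ?_ ?_, quasiIso_of_refinements g ?_ ?_⟩
  · exact fun T x hx y hy ↦ hbound x hx (f_inj x hx y hy)
  · intro T y hy
    let z := M.liftCycles y () rfl hy
    obtain ⟨T₁, π₁, _, e, he⟩ := surjective_up_to_refinements_of_epi (r ≫ M.homologyπ ())
      (z ≫ M.homologyπ ())
    obtain ⟨T₂, π₂, _, u, hu⟩ := hq.exact_up_to_refinements (π₁ ≫ z - e ≫ r) (by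
      simp [he])
    refine ⟨T₂, π₂ ≫ π₁, inferInstance, (π₂ ≫ e) ≫ (biprod.inr : E ⟶ M.X () ⊞ E),
      hinr _, u, ?_⟩
    change _ = ((π₂ ≫ e) ≫ biprod.inr) ≫ biprod.desc (𝟙 _) (r ≫ M.iCycles ()) + u ≫ M.d () ()
    have := congrArg (· ≫ M.iCycles ()) hu
    simp [z] at this
    simp [← this]
  · exact fun T x hx y hy ↦ hbound x hx (g_inj x y hy)
  · intro T y hy
    obtain ⟨T₁, π₁, _, e, he⟩ := surjective_up_to_refinements_of_epi (r ≫ M.homologyπ ()) y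
    exact ⟨T₁, π₁, inferInstance, e ≫ (biprod.inr : E ⟶ M.X () ⊞ E), hinr _, 0, g_surj e _ he⟩

/-- **Statement 8**: two `1`-periodic complexes are isomorphic in `D₁(A)` iff their
cohomologies are isomorphic in `A`; in particular every `1`-periodic complex is isomorphic
in `D₁(A)` to the stalk complex on its cohomology. -/
theorem iso_in_one_periodic_derived_category_iff_iso_cohomology
    (k : Type) [Field k] [Fintype k]
    {A : Type u} [Category.{v} A] [Abelian A] [Linear k A] [EssentiallySmall.{v} A]
    [HasExt.{w} A] [∀ X Y : A, Finite (X ⟶ Y)]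
    (hExtFin : ∀ X Y : A, Finite (Abelian.Ext X Y 1))
    (hHered : ∀ X Y : A, Subsingleton (Abelian.Ext X Y 2))
    [MorphismProperty.HasLocalization.{w'} (HomologicalComplex.quasiIso A oneShape)] :
    (∀ X Y : OnePeriodic A,
      Nonempty (QD.obj X ≅ QD.obj Y) ↔ Nonempty (cohomology X ≅ cohomology Y)) ∧
    (∀ X : OnePeriodic A, Nonempty (QD.obj X ≅ QD.obj (stalkC (cohomology X)))) := by
  have stalk (X : OnePeriodic A) : Nonempty (QD.obj X ≅ QD.obj (stalkC (cohomology X))) := by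
    obtain ⟨W, f, g, hf, hg⟩ := exists_quasiIso_roof_stalkC_cohomology hHered X
    exact ⟨(Localization.isoOfHom QD _ f hf).symm ≪≫ Localization.isoOfHom QD _ g hg⟩
  refine ⟨fun X Y ↦ ⟨fun ⟨e⟩ ↦ ?_, fun ⟨e⟩ ↦ ?_⟩, stalk⟩
  · let F := HomologicalComplexUpToQuasiIso.homologyFunctorFactors A oneShape ()
    exact ⟨(F.app X).symm ≪≫
      (HomologicalComplexUpToQuasiIso.homologyFunctor A oneShape ()).mapIso e ≪≫ F.app Y⟩
  · obtain ⟨eX⟩ := stalk X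
    obtain ⟨eY⟩ := stalk Y
    let s : stalkC (cohomology X) ≅ stalkC (cohomology Y) :=
      { hom := stalkHom e.hom
        inv := stalkHom e.inv
        hom_inv_id := by ext; simp [stalkHom, stalkC]
        inv_hom_id := by ext; simp [stalkHom, stalkC] }
    exact ⟨eX ≪≫ QD.mapIso s ≪≫ eY.symm⟩

end
end

section
/- Let A be a hereditary abelian category and C₁(A) the abelian category of 1-periodic complexes over A. Then for any acyclic 1-periodic complex K• and any integer p ≥ 2, the functors Ext^p_{C₁(A)}(K•, −) and Ext^p_{C₁(A)}(−, K•) vanish. -/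
/-!
Formalization of statements from "ıquantum groups of split type via derived Hall algebras"
(Chen–Lu–Ruan).  We set up 1-periodic complexes, the 1-periodic derived category,
derived Hall algebras and ıHall algebras.
-/

open CategoryTheory Limits

noncomputable section

universe w w' w'' v u

section Effaceability

open CategoryTheory.Abelian HomologicalComplex
open _root_.DerivedCategory

variable {C : Type u} [Category.{v} C] [Abelian C]

lemma CochainComplex.epi_f_of_quasiIsoAt_single {X : C} {K : CochainComplex C ℤ} {i : ℤ}
    (s : K ⟶ (single C (ComplexShape.up ℤ) i).obj X) [K.IsStrictlyLE i] [QuasiIsoAt s i] :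
    Epi (s.f i) := by
  let e := K.iCyclesIso i (i + 1) (by simp)
    ((K.isZero_of_isStrictlyLE i (i + 1) (by simp)).eq_of_tgt _ _)
  have : s.f i = (e.inv ≫ K.homologyπ i ≫ homologyMap s i ≫
      (singleObjHomologySelfIso _ _ _).hom) ≫ (singleObjXSelf (ComplexShape.up ℤ) i X).inv := by
    rw [← cancel_epi e.hom]
    dsimp [e]
    rw [Category.assoc, Category.assoc, Category.assoc, Iso.hom_inv_id_assoc,
      homologyπ_naturality_assoc]
    rw [homologyπ_singleObjHomologySelfIso_hom_assoc,
      ← singleObjCyclesSelfIso_inv_iCycles, Iso.hom_inv_id_assoc, cyclesMap_i, iCyclesIso_hom]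
  rw [this]
  infer_instance

lemma CochainComplex.mono_f_of_quasiIsoAt_single {X : C} {K : CochainComplex C ℤ} {i : ℤ}
    (s : (single C (ComplexShape.up ℤ) i).obj X ⟶ K) [K.IsStrictlyGE i] [QuasiIsoAt s i] :
    Mono (s.f i) := by
  let e := K.pOpcyclesIso (i - 1) i (by simp)
    ((K.isZero_of_isStrictlyGE i (i - 1) (by simp)).eq_of_src _ _)
  have : s.f i = (singleObjXSelf (ComplexShape.up ℤ) i X).hom ≫
      ((singleObjHomologySelfIso _ _ _).inv ≫ homologyMap s i ≫ K.homologyι i ≫ e.inv) := by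
    rw [← cancel_mono e.hom]
    dsimp [e]
    rw [Category.assoc, Category.assoc, Category.assoc, Category.assoc, Iso.inv_hom_id,
      Category.comp_id, homologyι_naturality]
    rw [singleObjHomologySelfIso_inv_homologyι_assoc,
      ← pOpcycles_singleObjOpcyclesSelfIso_inv_assoc, Iso.inv_hom_id_assoc, p_opcyclesMap,
      pOpcyclesIso_hom]
  rw [this]
  infer_instance

variable [HasExt.{w} C]

/-- Every `Ext`-class of positive degree is killed by an epimorphism onto its source. -/
lemma CategoryTheory.Abelian.Ext.exists_epi_mk₀_comp_eq_zero_s6 {X Y : C} {n : ℕ}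
    (e : Ext X Y (n + 1)) :
    ∃ (E : C) (π : E ⟶ X) (_ : Epi π), (Ext.mk₀ π).comp e (zero_add _) = 0 := by
  let := HasDerivedCategory.standard C
  let t := ((singleFunctors C).shiftIso ((n + 1 : ℕ) : ℤ) (-((n + 1 : ℕ) : ℤ)) 0 (by lia)).hom.app Y
  let φ : Q.obj ((CochainComplex.singleFunctor C 0).obj X) ⟶
    Q.obj ((CochainComplex.singleFunctor C (-((n + 1 : ℕ) : ℤ))).obj Y) := e.hom ≫ t
  obtain ⟨K, _, s, hs, g, fac⟩ := right_fac_of_isStrictlyLE φ 0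
  let ι : (CochainComplex.singleFunctor C 0).obj (K.X 0) ⟶ K :=
    mkHomFromSingle (𝟙 (K.X 0)) (by
      rintro i rfl
      apply (K.isZero_of_isStrictlyLE 0 (0 + 1) (by simp)).eq_of_tgt)
  have hι : ι ≫ g = 0 := by
    apply HomologicalComplex.from_single_hom_ext
    apply (isZero_single_obj_X _ _ _ _ (by lia)).eq_of_tgt
  let s' : K ⟶ (single C (ComplexShape.up ℤ) 0).obj X := s
  have : QuasiIso s' := (isIso_Q_map_iff_quasiIso _ s).1 hs
  have : Epi (s'.f 0) := CochainComplex.epi_f_of_quasiIsoAt_single s'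
  let π : K.X 0 ⟶ X := s'.f 0 ≫ (singleObjXSelf (ComplexShape.up ℤ) 0 X).hom
  have hπ : (CochainComplex.singleFunctor C 0).map π = ι ≫ s := by
    apply HomologicalComplex.from_single_hom_ext
    rw [comp_f, mkHomFromSingle_f]
    exact (single_map_f_self _ _ _).trans (by simp [π]; rfl)
  refine ⟨K.X 0, π, epi_comp _ _, Ext.homEquiv.injective ?_⟩
  have h0 : Q.map ((CochainComplex.singleFunctor C 0).map π) ≫ φ = 0 := by
    rw [hπ, fac, Q.map_comp, Category.assoc, IsIso.hom_inv_id_assoc, ← Q.map_comp, hι, Q.map_zero]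
  simp only [← cancel_mono t, Ext.comp_hom, Ext.mk₀_hom, Ext.zero_hom, ShiftedHom.mk₀_comp,
    Limits.zero_comp, Category.assoc]
  exact h0

/-- Every `Ext`-class of positive degree is killed by a monomorphism from its target. -/
lemma CategoryTheory.Abelian.Ext.exists_mono_comp_mk₀_eq_zero {X Y : C} {n : ℕ}
    (e : Ext X Y (n + 1)) :
    ∃ (E : C) (ι : Y ⟶ E) (_ : Mono ι), e.comp (Ext.mk₀ ι) (add_zero _) = 0 := by
  let := HasDerivedCategory.standard C
  let m : ℤ := -((n + 1 : ℕ) : ℤ)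
  let t := ((singleFunctors C).shiftIso ((n + 1 : ℕ) : ℤ) m 0 (by lia)).hom
  let φ : Q.obj ((CochainComplex.singleFunctor C 0).obj X) ⟶
    Q.obj ((CochainComplex.singleFunctor C m).obj Y) := e.hom ≫ t.app Y
  obtain ⟨K, _, g, s, hs, fac⟩ := left_fac_of_isStrictlyGE φ m
  let ρ : K ⟶ (CochainComplex.singleFunctor C m).obj (K.X m) :=
    mkHomToSingle (𝟙 (K.X m)) (by
      rintro i hi
      apply (K.isZero_of_isStrictlyGE m i (by simp at hi; lia)).eq_of_src)
  have hρ : g ≫ ρ = 0 := by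
    apply HomologicalComplex.to_single_hom_ext
    apply (isZero_single_obj_X _ _ _ _ (by lia)).eq_of_src
  let s' : (single C (ComplexShape.up ℤ) m).obj Y ⟶ K := s
  have : QuasiIso s' := (isIso_Q_map_iff_quasiIso _ s).1 hs
  have : Mono (s'.f m) := CochainComplex.mono_f_of_quasiIsoAt_single s'
  let ι : Y ⟶ K.X m := (singleObjXSelf (ComplexShape.up ℤ) m Y).inv ≫ s'.f m
  have hι : (CochainComplex.singleFunctor C m).map ι = s ≫ ρ := by
    apply HomologicalComplex.to_single_hom_ext
    rw [comp_f, mkHomToSingle_f]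
    exact (single_map_f_self _ _ _).trans (by simp [ι]; rfl)
  refine ⟨K.X m, ι, mono_comp _ _, Ext.homEquiv.injective ?_⟩
  have h0 : φ ≫ Q.map ((CochainComplex.singleFunctor C m).map ι) = 0 := by
    rw [hι, fac, Q.map_comp, Category.assoc, IsIso.inv_hom_id_assoc, ← Q.map_comp, hρ, Q.map_zero]
  simp only [← cancel_mono (t.app _), Ext.comp_hom, Ext.mk₀_hom, Ext.zero_hom,
    ShiftedHom.comp_mk₀, Limits.zero_comp, Category.assoc]
  refine (congrArg (e.hom ≫ ·) (t.naturality ι)).trans ?_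
  rw [← Category.assoc]
  exact h0

end Effaceability

section AcyclicOnePeriodic

open CategoryTheory.Abelian HomologicalComplex

variable {A : Type u} [Category.{v} A] [Abelian A]

/-- The morphism from the free acyclic complex `K_Y` corresponding to `Y ⟶ M.X ()`. -/
def KC.desc {Y : A} {M : OnePeriodic A} (g : Y ⟶ M.X ()) : KC Y ⟶ M where
  f _ := biprod.desc (g ≫ M.d () ()) g
  comm' _ _ _ := by
    change biprod.desc (g ≫ M.d () ()) g ≫ M.d () () =
      (biprod.snd ≫ (biprod.inl : Y ⟶ Y ⊞ Y)) ≫ biprod.desc (g ≫ M.d () ()) g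
    ext <;> simp

/-- The morphism to the cofree acyclic complex `K_Y` corresponding to `M.X () ⟶ Y`. -/
def KC.lift {Y : A} {M : OnePeriodic A} (g : M.X () ⟶ Y) : M ⟶ KC Y where
  f _ := biprod.lift g (M.d () () ≫ g)
  comm' _ _ _ := by
    change biprod.lift g (M.d () () ≫ g) ≫ (biprod.snd : Y ⊞ Y ⟶ Y) ≫ biprod.inl =
      M.d () () ≫ biprod.lift g (M.d () () ≫ g)
    ext <;> simp

lemma KC.isAcyclic (Y : A) : IsAcyclic (KC Y) := by
  intro i
  change (ShortComplex.mk ((biprod.snd : Y ⊞ Y ⟶ Y) ≫ biprod.inl)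
    ((biprod.snd : Y ⊞ Y ⟶ Y) ≫ biprod.inl) (by simp)).Exact
  rw [ShortComplex.exact_iff_exact_up_to_refinements]
  intro T x hx
  dsimp at x hx
  refine ⟨T, 𝟙 T, inferInstance, x ≫ biprod.fst ≫ biprod.inr, ?_⟩
  have h : x ≫ biprod.snd = 0 := by
    rwa [← cancel_mono (biprod.inl : Y ⟶ Y ⊞ Y), Category.assoc, zero_comp]
  dsimp
  apply biprod.hom_ext <;> simp [h]

lemma KC.epi_desc_id (M : OnePeriodic A) : Epi (KC.desc (𝟙 (M.X ()))) :=
  epi_of_epi_f _ fun _ ↦ epi_of_epi_fac (f := biprod.inr)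
    (biprod.inr_desc (𝟙 (M.X ()) ≫ M.d () ()) (𝟙 (M.X ())))

lemma KC.mono_lift_id (M : OnePeriodic A) : Mono (KC.lift (𝟙 (M.X ()))) :=
  mono_of_mono_f _ fun _ ↦ mono_of_mono_fac
    (biprod.lift_fst (𝟙 (M.X ())) (M.d () () ≫ 𝟙 (M.X ())))

lemma isAcyclic_X₁ {S : ShortComplex (OnePeriodic A)} (hS : S.ShortExact)
    (h₂ : IsAcyclic S.X₂) (h₃ : IsAcyclic S.X₃) : IsAcyclic S.X₁ := fun i ↦ by
  rw [exactAt_iff_isZero_homology]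
  exact (hS.homology_exact₁ i i trivial).isZero_X₂
    ((h₃ i).isZero_homology.eq_of_src _ _) ((h₂ i).isZero_homology.eq_of_tgt _ _)

lemma isAcyclic_X₃ {S : ShortComplex (OnePeriodic A)} (hS : S.ShortExact)
    (h₁ : IsAcyclic S.X₁) (h₂ : IsAcyclic S.X₂) : IsAcyclic S.X₃ := fun i ↦ by
  rw [exactAt_iff_isZero_homology]
  exact (hS.homology_exact₃ i i trivial).isZero_X₂
    ((h₂ i).isZero_homology.eq_of_src _ _) ((h₁ i).isZero_homology.eq_of_tgt _ _)

lemma mono_fromOpcycles {K : OnePeriodic A} (hK : IsAcyclic K) : Mono (K.fromOpcycles () ()) :=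
  (hK ()).mono_fromOpcycles

lemma epi_toCycles {K : OnePeriodic A} (hK : IsAcyclic K) : Epi (K.toCycles () ()) :=
  (hK ()).epi_toCycles

/-- The cokernels of the differentials in a short exact sequence of complexes. -/
abbrev opcyclesShortComplex (S : ShortComplex (OnePeriodic A)) : ShortComplex A :=
  ShortComplex.mk (opcyclesMap S.f ()) (opcyclesMap S.g ())
    (by rw [← opcyclesMap_comp, S.zero, opcyclesMap_zero])

/-- The kernels of the differentials in a short exact sequence of complexes. -/
abbrev cyclesShortComplex (S : ShortComplex (OnePeriodic A)) : ShortComplex A :=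
  ShortComplex.mk (cyclesMap S.f ()) (cyclesMap S.g ())
    (by rw [← cyclesMap_comp, S.zero, cyclesMap_zero])

lemma opcyclesShortComplex_shortExact {S : ShortComplex (OnePeriodic A)} (hS : S.ShortExact)
    (h₁ : IsAcyclic S.X₁) : (opcyclesShortComplex S).ShortExact := by
  have := hS.mono_f
  have := hS.epi_g
  have : Mono (opcyclesMap S.f ()) := by
    have := mono_fromOpcycles h₁
    have : Mono (opcyclesMap S.f () ≫ S.X₂.fromOpcycles () ()) := by
      have : opcyclesMap S.f () ≫ S.X₂.fromOpcycles () () =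
          S.X₁.fromOpcycles () () ≫ S.f.f () := by
        simp [← cancel_epi (S.X₁.pOpcycles ())]
      rw [this]
      infer_instance
    exact mono_of_mono _ (S.X₂.fromOpcycles () ())
  exact { exact := opcycles_right_exact S hS.exact ()
          mono_f := this
          epi_g := inferInstanceAs (Epi (opcyclesMap S.g ())) }

lemma cyclesShortComplex_shortExact {S : ShortComplex (OnePeriodic A)} (hS : S.ShortExact)
    (h₃ : IsAcyclic S.X₃) : (cyclesShortComplex S).ShortExact := by
  have := hS.mono_f
  have := hS.epi_g
  have : Epi (cyclesMap S.g ()) := by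
    have := epi_toCycles h₃
    have : Epi (S.X₂.toCycles () () ≫ cyclesMap S.g ()) := by
      have : S.X₂.toCycles () () ≫ cyclesMap S.g () =
          S.g.f () ≫ S.X₃.toCycles () () := by
        simp [← cancel_mono (S.X₃.iCycles ())]
      rw [this]
      infer_instance
    exact epi_of_epi (S.X₂.toCycles () ()) _
  exact { exact := cycles_left_exact S hS.exact ()
          mono_f := inferInstanceAs (Mono (cyclesMap S.f ()))
          epi_g := this }

/-- The functor sending an object to its stalk complex. -/
abbrev stalkFunctor (A : Type u) [Category.{v} A] [Abelian A] : A ⥤ OnePeriodic A :=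
  single A oneShape ()

/-- The projection of a complex onto the stalk complex of the cokernel of its differential. -/
def toStalkOpcycles (M : OnePeriodic A) : M ⟶ (stalkFunctor A).obj (M.opcycles ()) :=
  mkHomToSingle (M.pOpcycles ()) (fun _ _ ↦ M.d_pOpcycles _ _)

/-- The inclusion of the stalk complex of the kernel of the differential. -/
def fromStalkCycles (M : OnePeriodic A) : (stalkFunctor A).obj (M.cycles ()) ⟶ M :=
  mkHomFromSingle (M.iCycles ()) (fun _ _ ↦ M.iCycles_d _ _)

lemma toStalkOpcycles_naturality {M N : OnePeriodic A} (φ : M ⟶ N) :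
    φ ≫ toStalkOpcycles N = toStalkOpcycles M ≫ (stalkFunctor A).map (opcyclesMap φ ()) := by
  apply to_single_hom_ext
  simp [toStalkOpcycles, single_map_f_self]

lemma fromStalkCycles_naturality {M N : OnePeriodic A} (φ : M ⟶ N) :
    fromStalkCycles M ≫ φ = (stalkFunctor A).map (cyclesMap φ ()) ≫ fromStalkCycles N := by
  apply from_single_hom_ext
  simp [fromStalkCycles, single_map_f_self]

lemma exists_toStalkOpcycles_comp {M : OnePeriodic A} {N : A} (φ : M ⟶ (stalkFunctor A).obj N) :
    ∃ ψ : M.opcycles () ⟶ N, toStalkOpcycles M ≫ (stalkFunctor A).map ψ = φ := by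
  refine ⟨M.descOpcycles (φ.f () ≫ (singleObjXSelf oneShape () N).hom) () rfl ?_, ?_⟩
  · rw [← Category.assoc, ← φ.comm]
    simp
  · apply to_single_hom_ext
    simp [toStalkOpcycles, single_map_f_self]

lemma exists_comp_fromStalkCycles {M : OnePeriodic A} {N : A} (φ : (stalkFunctor A).obj N ⟶ M) :
    ∃ ψ : N ⟶ M.cycles (), (stalkFunctor A).map ψ ≫ fromStalkCycles M = φ := by
  refine ⟨M.liftCycles ((singleObjXSelf oneShape () N).inv ≫ φ.f ()) () rfl ?_, ?_⟩
  · rw [Category.assoc, φ.comm]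
    simp
  · apply from_single_hom_ext
    simp [fromStalkCycles, single_map_f_self]

/-- Every `1`-periodic complex is an extension of stalk complexes. -/
lemma exists_stalk_shortExact (M : OnePeriodic A) :
    ∃ (Z B : A) (i : (stalkFunctor A).obj Z ⟶ M) (q : M ⟶ (stalkFunctor A).obj B) (w : i ≫ q = 0),
      (ShortComplex.mk i q w).ShortExact := by
  have hd : M.d () () ≫ cokernel.π (M.iCycles ()) = 0 := by
    rw [← M.toCycles_i () (), Category.assoc, cokernel.condition, comp_zero]
  let q : M ⟶ (stalkFunctor A).obj (cokernel (M.iCycles ())) :=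
    mkHomToSingle (cokernel.π (M.iCycles ())) (fun _ _ ↦ hd)
  have w : fromStalkCycles M ≫ q = 0 := by
    apply from_single_hom_ext
    simp [fromStalkCycles, q]
  refine ⟨_, _, fromStalkCycles M, q, w, shortExact_of_degreewise_shortExact _ fun _ ↦ ?_⟩
  have h : (ShortComplex.mk (M.iCycles ()) (cokernel.π (M.iCycles ()))
      (cokernel.condition _)).ShortExact :=
    { exact := ShortComplex.exact_of_g_is_cokernel _ (cokernelIsCokernel _) }
  refine ShortComplex.shortExact_of_iso ?_ h
  refine ShortComplex.isoMk (singleObjXSelf oneShape () _).symm (Iso.refl _)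
    (singleObjXSelf oneShape () _).symm ?_ ?_
  · simp [fromStalkCycles]
    exact (Iso.inv_hom_id_assoc _ _).trans (Category.comp_id _).symm
  · simp [q]
    exact Category.id_comp _

section

variable {K : OnePeriodic A} [HasExt.{w'} (OnePeriodic A)]

/-- An `Ext`-class of positive degree out of an acyclic complex factors through the class of a
short exact sequence whose subobject is acyclic. -/
lemma exists_acyclic_cover (hK : IsAcyclic K) {M : OnePeriodic A} {n : ℕ}
    (e : Ext K M (n + 1)) :
    ∃ (L J : OnePeriodic A) (i : L ⟶ J) (q : J ⟶ K) (w : i ≫ q = 0)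
      (hS : (ShortComplex.mk i q w).ShortExact) (f : Ext L M n),
      IsAcyclic L ∧ e = hS.extClass.comp f (add_comm 1 n) := by
  obtain ⟨E, π, _, hπ⟩ := Ext.exists_epi_mk₀_comp_eq_zero_s6 e
  have := KC.epi_desc_id E
  let q := KC.desc (𝟙 (E.X ())) ≫ π
  have hS : (ShortComplex.mk _ _ (kernel.condition q)).ShortExact :=
    { exact := ShortComplex.exact_of_f_is_kernel _ (kernelIsKernel q)
      epi_g := epi_comp _ _ }
  obtain ⟨f, hf⟩ := Ext.contravariant_sequence_exact₃ hS _ e (by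
    dsimp only [q]
    rw [← Ext.mk₀_comp_mk₀_assoc, hπ, Ext.comp_zero]) (add_comm 1 n)
  exact ⟨_, _, _, _, _, hS, f, isAcyclic_X₁ hS (KC.isAcyclic _) hK, hf.symm⟩

/-- An `Ext`-class of positive degree into an acyclic complex factors through the class of a
short exact sequence whose quotient is acyclic. -/
lemma exists_acyclic_hull (hK : IsAcyclic K) {M : OnePeriodic A} {n : ℕ}
    (e : Ext M K (n + 1)) :
    ∃ (L J : OnePeriodic A) (i : K ⟶ J) (q : J ⟶ L) (w : i ≫ q = 0)
      (hS : (ShortComplex.mk i q w).ShortExact) (f : Ext M L n),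
      IsAcyclic L ∧ e = f.comp hS.extClass rfl := by
  obtain ⟨E, ι, _, hι⟩ := Ext.exists_mono_comp_mk₀_eq_zero e
  have := KC.mono_lift_id E
  let i := ι ≫ KC.lift (𝟙 (E.X ()))
  have hS : (ShortComplex.mk _ _ (cokernel.condition i)).ShortExact :=
    { exact := ShortComplex.exact_of_g_is_cokernel _ (cokernelIsCokernel i)
      mono_f := mono_comp _ _ }
  obtain ⟨f, hf⟩ := Ext.covariant_sequence_exact₁ _ hS e (by
    dsimp only [i]
    rw [← Ext.mk₀_comp_mk₀, ← Ext.comp_assoc_of_third_deg_zero, hι, Ext.zero_comp]) rfl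
  exact ⟨_, _, _, _, _, hS, f, isAcyclic_X₃ hS hK (KC.isAcyclic _), hf.symm⟩

variable [HasExt.{w} A]

/-- `Ext¹`-classes from an acyclic complex to a stalk complex come from `A`. -/
lemma exists_mk₀_toStalkOpcycles_comp (hK : IsAcyclic K) {N : A}
    (f : Ext K ((stalkFunctor A).obj N) 1) :
    ∃ φ : Ext (K.opcycles ()) N 1,
      f = (Ext.mk₀ (toStalkOpcycles K)).comp (φ.mapExactFunctor (stalkFunctor A)) (zero_add 1) := by
  obtain ⟨L, J, i, q, w, hS, h, hL, rfl⟩ := exists_acyclic_cover hK f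
  obtain ⟨h, rfl⟩ := (Ext.mk₀_bijective _ _).2 h
  obtain ⟨ψ, rfl⟩ := exists_toStalkOpcycles_comp h
  have hS' := opcyclesShortComplex_shortExact hS hL
  let τ : ShortComplex.mk i q w ⟶ (opcyclesShortComplex (ShortComplex.mk i q w)).map
      (stalkFunctor A) :=
    { τ₁ := toStalkOpcycles L
      τ₂ := toStalkOpcycles J
      τ₃ := toStalkOpcycles K
      comm₁₂ := (toStalkOpcycles_naturality i).symm
      comm₂₃ := (toStalkOpcycles_naturality q).symm }
  have hτ : hS.extClass.comp (Ext.mk₀ (toStalkOpcycles L)) (add_zero 1) =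
      (Ext.mk₀ (toStalkOpcycles K)).comp (hS'.extClass.mapExactFunctor (stalkFunctor A))
        (zero_add 1) := by
    rw [Ext.mapExactFunctor_extClass]
    exact ShortComplex.ShortExact.extClass_naturality hS (hS'.map_of_exact (stalkFunctor A)) τ
  refine ⟨hS'.extClass.comp (Ext.mk₀ ψ) (add_zero 1), ?_⟩
  rw [Ext.mapExactFunctor_comp, Ext.mapExactFunctor_mk₀, ← Ext.mk₀_comp_mk₀,
    ← Ext.comp_assoc_of_third_deg_zero, ← Ext.comp_assoc_of_third_deg_zero, hτ]

/-- `Ext¹`-classes from a stalk complex to an acyclic complex come from `A`. -/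
lemma exists_comp_mk₀_fromStalkCycles (hK : IsAcyclic K) {N : A}
    (f : Ext ((stalkFunctor A).obj N) K 1) :
    ∃ φ : Ext N (K.cycles ()) 1,
      f = (φ.mapExactFunctor (stalkFunctor A)).comp (Ext.mk₀ (fromStalkCycles K)) (add_zero 1) := by
  obtain ⟨L, J, i, q, w, hS, h, hL, rfl⟩ := exists_acyclic_hull hK f
  obtain ⟨h, rfl⟩ := (Ext.mk₀_bijective _ _).2 h
  obtain ⟨ψ, rfl⟩ := exists_comp_fromStalkCycles h
  have hS' := cyclesShortComplex_shortExact hS hL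
  let τ : (cyclesShortComplex (ShortComplex.mk i q w)).map (stalkFunctor A) ⟶
      ShortComplex.mk i q w :=
    { τ₁ := fromStalkCycles K
      τ₂ := fromStalkCycles J
      τ₃ := fromStalkCycles L
      comm₁₂ := fromStalkCycles_naturality i
      comm₂₃ := fromStalkCycles_naturality q }
  have hτ : (hS'.extClass.mapExactFunctor (stalkFunctor A)).comp (Ext.mk₀ (fromStalkCycles K))
      (add_zero 1) = (Ext.mk₀ (fromStalkCycles L)).comp hS.extClass (zero_add 1) := by
    rw [Ext.mapExactFunctor_extClass]
    exact ShortComplex.ShortExact.extClass_naturality (hS'.map_of_exact (stalkFunctor A)) hS τ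
  refine ⟨(Ext.mk₀ ψ).comp hS'.extClass (zero_add 1), ?_⟩
  rw [Ext.mapExactFunctor_comp, Ext.mapExactFunctor_mk₀, ← Ext.mk₀_comp_mk₀,
    Ext.comp_assoc_of_third_deg_zero, Ext.comp_assoc_of_second_deg_zero, hτ]

lemma ext_stalk_eq_zero (hHered : ∀ X Y : A, Subsingleton (Ext X Y 2))
    (hK : IsAcyclic K) {N : A} (n : ℕ) (e : Ext K ((stalkFunctor A).obj N) (n + 2)) : e = 0 := by
  induction n generalizing K with
  | zero =>
    obtain ⟨L, J, i, q, w, hS, f, hL, rfl⟩ := exists_acyclic_cover hK e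
    obtain ⟨φ, rfl⟩ := exists_mk₀_toStalkOpcycles_comp hL f
    obtain ⟨ψ, rfl⟩ := Ext.contravariant_sequence_exact₁ (opcyclesShortComplex_shortExact hS hL) _ φ
      (add_comm 1 1) ((hHered _ _).elim _ _)
    rw [Ext.mapExactFunctor_comp, Ext.mapExactFunctor_mk₀, Ext.mk₀_comp_mk₀_assoc,
      ← toStalkOpcycles_naturality i, ← Ext.mk₀_comp_mk₀_assoc, hS.extClass_comp_assoc]
  | succ n ih =>
    obtain ⟨L, J, i, q, w, hS, f, hL, rfl⟩ := exists_acyclic_cover hK e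
    rw [ih hL f, Ext.comp_zero]

lemma ext_of_stalk_eq_zero (hHered : ∀ X Y : A, Subsingleton (Ext X Y 2))
    (hK : IsAcyclic K) {N : A} (n : ℕ) (e : Ext ((stalkFunctor A).obj N) K (n + 2)) : e = 0 := by
  induction n generalizing K with
  | zero =>
    obtain ⟨L, J, i, q, w, hS, f, hL, rfl⟩ := exists_acyclic_hull hK e
    obtain ⟨φ, rfl⟩ := exists_comp_mk₀_fromStalkCycles hL f
    obtain ⟨ψ, rfl⟩ := Ext.covariant_sequence_exact₃ _ (cyclesShortComplex_shortExact hS hL) φ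
      rfl ((hHered _ _).elim _ _)
    rw [Ext.mapExactFunctor_comp, Ext.mapExactFunctor_mk₀, Ext.comp_assoc_of_third_deg_zero,
      Ext.mk₀_comp_mk₀]
    rw [← fromStalkCycles_naturality q, ← Ext.mk₀_comp_mk₀, ← Ext.comp_assoc_of_third_deg_zero,
      Ext.comp_assoc_of_second_deg_zero, hS.comp_extClass, Ext.comp_zero]
  | succ n ih =>
    obtain ⟨L, J, i, q, w, hS, f, hL, rfl⟩ := exists_acyclic_hull hK e
    rw [ih hL f, Ext.zero_comp]

end

end AcyclicOnePeriodic

/-- **Statement 9** (Lemma 2.2 of the paper): for a hereditary abelian category `A`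
(`Ext²` vanishes identically), any acyclic `1`-periodic complex `K•` and any `p ≥ 2`,
the functors `Ext^p_{C₁(A)}(K•, -)` and `Ext^p_{C₁(A)}(-, K•)` vanish. -/
theorem ext_p_vanishing_for_acyclic_one_periodic_complexes
    {A : Type u} [Category.{v} A] [Abelian A] [EssentiallySmall.{v} A]
    [HasExt.{w} A] [HasExt.{w'} (OnePeriodic A)]
    (hHered : ∀ X Y : A, Subsingleton (Abelian.Ext X Y 2))
    (K : OnePeriodic A) (hK : IsAcyclic K) (p : ℕ) (hp : 2 ≤ p) :
    (∀ M : OnePeriodic A, Subsingleton (Abelian.Ext K M p)) ∧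
    (∀ M : OnePeriodic A, Subsingleton (Abelian.Ext M K p)) := by
  obtain ⟨n, rfl⟩ : ∃ n, p = n + 2 := ⟨p - 2, by omega⟩
  refine ⟨fun M ↦ subsingleton_of_forall_eq 0 fun x ↦ ?_,
    fun M ↦ subsingleton_of_forall_eq 0 fun x ↦ ?_⟩
  all_goals obtain ⟨Z, B, i, q, w, hS⟩ := exists_stalk_shortExact M
  · obtain ⟨y, rfl⟩ := Abelian.Ext.covariant_sequence_exact₂ K hS x
      (ext_stalk_eq_zero hHered hK n _)
    rw [ext_stalk_eq_zero hHered hK n y, Abelian.Ext.zero_comp]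
  · obtain ⟨y, rfl⟩ := Abelian.Ext.contravariant_sequence_exact₂ hS K x
      (ext_of_stalk_eq_zero hHered hK n _)
    rw [ext_of_stalk_eq_zero hHered hK n y, Abelian.Ext.comp_zero]

end
end
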